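/- arXiv:1908.01388 — 2 statements merged into one kernel-verified Lean document; each statement's English description precedes it below -/
import Mathlib

section
/- Let n ≥ 2, p ∈ [1,∞] (with the convention 1/p = 0 for p = ∞), 0 < q < 1, and c(x,y) := ‖x − y‖_p^q on ℝⁿ. Let V_{n,p} := 2^n · Γ(1 + 1/p)^n / Γ(1 + n/p) be the volume of the unit ℓ_p ball in ℝⁿ. Then r*_c(P(ℝⁿ)) ≥ (1 − 1/n) · ( (n + q)/(n + q − n·q) · ( (n/q + 1)/V_{n,p} )^{1/(n/q + 1)} + 1/(n − 1) − min{ 2^{−q}·n^{q/p + 1}/(n + q), max{ ( (n/q + 1)/V_{n,p} )^{1/(n/q + 1)} − 1, 0 } + q·n^{1/p + 1}/(2(n + 1)) } ). In particular, as n → ∞ one has r*_c(P(ℝⁿ)) = Ω(n^{q/p}). -/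
open MeasureTheory ENNReal

noncomputable section

/-- The optimal transport cost `C*_c(P,Q)` between two Borel measures for the cost `c`:
the infimum of `∫ c dγ` over couplings `γ` of `(P, Q)`. -/
def Cstar {X : Type*} [MeasurableSpace X] (c : X → X → ℝ) (P Q : Measure X) : ℝ≥0∞ :=
  ⨅ γ ∈ {γ : Measure (X × X) |
      IsProbabilityMeasure γ ∧ γ.map Prod.fst = P ∧ γ.map Prod.snd = Q},
    ∫⁻ z, ENNReal.ofReal (c z.1 z.2) ∂γ

/-- The standard probability space: `[0,1]` with Lebesgue measure. -/
def stdSpace : Measure ℝ := volume.restrict (Set.Icc (0 : ℝ) 1)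

/-- `f` is a coupling of the family of probability measures `P` on the standard
probability space `([0,1], Lebesgue)`: each `f a` is measurable with law `P a`. -/
structure IsCoupling {X A : Type*} [MeasurableSpace X]
    (P : A → Measure X) (f : A → ℝ → X) : Prop where
  measurable : ∀ a, Measurable (f a)
  law : ∀ a, stdSpace.map (f a) = P a

/-- The pairwise coupling ratio `r_c({X_α})` of a coupling `f` of the family `P`:
the least `r ≥ 1` such that `E[c(X_a, X_b)] ≤ r ⬝ C*_c(P_a, P_b)` for all `a, b`
(`∞` if no such `r` exists). -/
def couplingRatio {X A : Type*} [MeasurableSpace X]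
    (c : X → X → ℝ) (P : A → Measure X) (f : A → ℝ → X) : ℝ≥0∞ :=
  sInf {r : ℝ≥0∞ | 1 ≤ r ∧ ∀ a b : A,
    ∫⁻ u, ENNReal.ofReal (c (f a u) (f b u)) ∂stdSpace ≤ r * Cstar c (P a) (P b)}

/-- The optimal pairwise coupling ratio `r*_c({P_α})` of a family of probability
measures: the infimum of `r_c({X_α})` over all couplings of the family. -/
def optRatio {X A : Type*} [MeasurableSpace X]
    (c : X → X → ℝ) (P : A → Measure X) : ℝ≥0∞ :=
  ⨅ (f : A → ℝ → X) (_ : IsCoupling P f), couplingRatio c P f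

open Classical in
/-- The `ℓ_p` norm on `ℝⁿ` for an extended real exponent `p ∈ [1,∞]`:
`‖z‖_p = (∑ i |z i|^p)^{1/p}` for finite `p`, and `‖z‖_∞ = max_i |z i|`. -/
def lpNorm (p : ℝ≥0∞) {n : ℕ} (z : Fin n → ℝ) : ℝ :=
  if p = ⊤ then ⨆ i, |z i| else (∑ i, |z i| ^ p.toReal) ^ (1 / p.toReal)

/-- `V_{m,p} = 2^m Γ(1 + 1/p)^m / Γ(1 + m/p)`: the volume of the unit `ℓ_p` ball in
`ℝ^m` (with the convention `1/p = 0` for `p = ∞`). -/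
def unitBallVolume (p : ℝ≥0∞) (m : ℕ) : ℝ :=
  2 ^ m * Real.Gamma (1 + (p⁻¹).toReal) ^ m / Real.Gamma (1 + m * (p⁻¹).toReal)

/-- The optimal pairwise coupling ratio `r*_c(P(ℝⁿ))` of the family of all Borel
probability measures on `ℝⁿ` for the cost `c(x,y) = ‖x − y‖_p^q`. -/
def lpOptRatio (n : ℕ) (p : ℝ≥0∞) (q : ℝ) : ℝ≥0∞ :=
  optRatio (fun x y : Fin n → ℝ => lpNorm p (x - y) ^ q)
    (fun P : ProbabilityMeasure (Fin n → ℝ) => (P : Measure (Fin n → ℝ)))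

lemma two_mul_le_tsum_variation (v : ℤ → ℝ≥0∞) (L : ℤ)
    (hv : ∀ t, t < 0 ∨ L ≤ t → v t = 0) (s : ℤ) :
    2 * v s ≤ ∑' t, ((v t - v (t + 1)) + (v (t + 1) - v t)) := by
  have hr : ∀ N : ℕ, v s ≤ ∑ j ∈ Finset.range N, (v (s + j) - v (s + j + 1)) + v (s + N) := by
    intro N
    induction N with
    | zero => simp
    | succ N ih =>
      rw [Finset.sum_range_succ, add_assoc]
      refine ih.trans ?_
      gcongr
      rw [Nat.cast_succ, ← add_assoc]
      exact le_tsub_add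
  have hl : ∀ N : ℕ, v s ≤
      ∑ j ∈ Finset.range N, (v (s - 1 - j + 1) - v (s - 1 - j)) + v (s - N) := by
    intro N
    induction N with
    | zero => simp
    | succ N ih =>
      rw [Finset.sum_range_succ, add_assoc]
      refine ih.trans ?_
      gcongr
      have h1 : s - 1 - (N : ℤ) + 1 = s - N := by ring
      have h2 : s - ((N + 1 : ℕ) : ℤ) = s - 1 - N := by push_cast; ring
      rw [h1, h2]
      exact le_tsub_add
  have hinj1 : Function.Injective (fun j : ℕ => s + (j : ℤ)) := by
    intro a b h; simpa using h
  have hinj2 : Function.Injective (fun j : ℕ => s - 1 - (j : ℤ)) := by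
    intro a b h; simpa using h
  rw [ENNReal.tsum_add, two_mul]
  refine add_le_add ?_ ?_
  · refine (hr (L - s).toNat).trans ?_
    rw [hv (s + (L - s).toNat) (by right; have := Int.self_le_toNat (L - s); linarith), add_zero]
    exact (ENNReal.sum_le_tsum _).trans
      (ENNReal.tsum_comp_le_tsum_of_injective hinj1 fun t => v t - v (t + 1))
  · refine (hl (s + 1).toNat).trans ?_
    rw [hv (s - (s + 1).toNat) (by left; have := Int.self_le_toNat (s + 1); linarith), add_zero]
    exact (ENNReal.sum_le_tsum _).trans
      (ENNReal.tsum_comp_le_tsum_of_injective hinj2 fun t => v (t + 1) - v t)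

/-- The weighted AM-GM inequality behind the induction on the dimension. -/
lemma succ_mul_rpow_le (n : ℕ) (hn : 1 ≤ n) (S m : ℝ≥0∞) (hS : S ≠ ∞) (hm0 : m ≠ 0) (hm : m ≠ ∞) :
    ((n + 1 : ℕ) : ℝ≥0∞) * S ^ (1 - 1 / ((n + 1 : ℕ) : ℝ)) ≤
      n * (S * m ^ (-(1 / (n : ℝ)))) + m := by
  lift S to NNReal using hS
  lift m to NNReal using hm
  have hm0' : m ≠ 0 := by simpa using hm0
  have hn' : (0 : ℝ) < n := by exact_mod_cast hn
  have hx : (0 : ℝ) ≤ 1 - 1 / ((n + 1 : ℕ) : ℝ) := by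
    push_cast
    rw [sub_nonneg, div_le_one (by positivity)]
    linarith
  rw [← ENNReal.coe_rpow_of_nonneg _ hx, ← ENNReal.coe_rpow_of_ne_zero hm0']
  norm_cast
  rw [← NNReal.coe_le_coe]
  push_cast
  have hmpos : (0 : ℝ) < m := by positivity
  have key := Real.geom_mean_le_arith_mean2_weighted (w₁ := n / (n + 1)) (w₂ := 1 / (n + 1))
    (p₁ := (S : ℝ) * (m : ℝ) ^ (-(1 / (n : ℝ)))) (p₂ := m) (by positivity) (by positivity)
    (by positivity) (by positivity) (by field_simp)
  rw [Real.mul_rpow (by positivity) (by positivity), ← Real.rpow_mul hmpos.le, mul_assoc,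
    ← Real.rpow_add hmpos] at key
  have e1 : -(1 / (n : ℝ)) * (n / (n + 1)) + 1 / (n + 1) = 0 := by field_simp; ring
  have e2 : (n : ℝ) / (n + 1) = 1 - 1 / (n + 1) := by field_simp; ring
  rw [e1, Real.rpow_zero, mul_one] at key
  have h3 := mul_le_mul_of_nonneg_left key (by positivity : (0 : ℝ) ≤ n + 1)
  rw [e2] at h3
  refine h3.trans (le_of_eq ?_)
  rw [← e2]
  field_simp

lemma cons_add_single_succ {n : ℕ} (t : ℤ) (x : Fin n → ℤ) (i : Fin n) :
    (Fin.cons t x : Fin (n + 1) → ℤ) + Pi.single i.succ 1 = Fin.cons t (x + Pi.single i 1) := by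
  ext j
  refine Fin.cases ?_ (fun k => ?_) j
  · simp
  · simp [Pi.single_apply]

lemma cons_add_single_zero {n : ℕ} (t : ℤ) (x : Fin n → ℤ) :
    (Fin.cons t x : Fin (n + 1) → ℤ) + Pi.single 0 1 = Fin.cons (t + 1) x := by
  ext j
  refine Fin.cases ?_ (fun k => ?_) j
  · simp
  · simp

/-- A discrete Sobolev inequality on `ℤⁿ` with the sharp constant, for finitely supported functions
whose nonzero values are at least `1`. -/
theorem discrete_sobolev (n : ℕ) (u : (Fin n → ℤ) → ℝ≥0∞) (L : ℤ)
    (hsupp : ∀ a, (∃ i, a i < 0 ∨ L ≤ a i) → u a = 0) (h01 : ∀ a, u a = 0 ∨ 1 ≤ u a)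
    (hS : ∑' a, u a ≠ ∞) (hS0 : ∑' a, u a ≠ 0) :
    2 * (n * (∑' a, u a) ^ (1 - 1 / (n : ℝ))) ≤
      ∑' a, ∑ i, ((u a - u (a + Pi.single i 1)) + (u (a + Pi.single i 1) - u a)) := by
  induction n with
  | zero => simp
  | succ n ih =>
    have hsplit : ∀ F : (Fin (n + 1) → ℤ) → ℝ≥0∞,
        ∑' a, F a = ∑' t : ℤ, ∑' x : Fin n → ℤ, F (Fin.cons t x) := by
      intro F
      rw [← (Fin.consEquiv (fun _ : Fin (n + 1) => ℤ)).tsum_eq, ENNReal.tsum_prod']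
      rfl
    set s : ℤ → ℝ≥0∞ := fun t => ∑' x : Fin n → ℤ, u (Fin.cons t x) with hs
    have hSs : ∑' a, u a = ∑' t, s t := hsplit u
    set m : ℝ≥0∞ := ⨆ t, s t with hm
    have hsS : ∀ t, s t ≤ ∑' t, s t := fun t => ENNReal.le_tsum t
    have hmS : m ≤ ∑' t, s t := iSup_le hsS
    rw [hSs] at hS hS0 ⊢
    have hmtop : m ≠ ∞ := ne_top_of_le_ne_top hS hmS
    obtain ⟨t₀, ht₀⟩ : ∃ t, s t ≠ 0 := by
      by_contra! h
      exact hS0 (by simp [h])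
    obtain ⟨x₀, hx₀⟩ : ∃ x, u (Fin.cons t₀ x) ≠ 0 := by
      by_contra! h
      exact ht₀ (by simp [hs, h])
    have hm1 : 1 ≤ m := by
      refine ((h01 _).resolve_left hx₀).trans ?_
      exact (ENNReal.le_tsum (f := fun x : Fin n → ℤ => u (Fin.cons t₀ x)) x₀).trans (le_iSup s t₀)
    have hm0 : m ≠ 0 := (zero_lt_one.trans_le hm1).ne'
    rw [hsplit]
    simp_rw [Fin.sum_univ_succ, cons_add_single_succ, cons_add_single_zero, ENNReal.tsum_add]
    have hvert : 2 * m ≤ ∑' (t : ℤ) (x : Fin n → ℤ),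
        ((u (Fin.cons t x) - u (Fin.cons (t + 1) x)) +
          (u (Fin.cons (t + 1) x) - u (Fin.cons t x))) := by
      rw [ENNReal.tsum_comm, hm, ENNReal.mul_iSup]
      refine iSup_le fun t => ?_
      rw [hs]
      simp only
      rw [← ENNReal.tsum_mul_left]
      refine ENNReal.tsum_le_tsum fun x => ?_
      refine two_mul_le_tsum_variation (fun t => u (Fin.cons t x)) L (fun t ht => ?_) t
      exact hsupp _ ⟨0, by simpa using ht⟩
    simp_rw [ENNReal.tsum_add] at hvert
    rcases Nat.eq_zero_or_pos n with hn | hn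
    · subst hn
      refine le_trans ?_ (le_self_add)
      refine le_trans ?_ hvert
      simpa using mul_le_mul_right hm1 2
    have hn1 : (1 : ℝ) ≤ n := by exact_mod_cast hn
    have hslice : ∀ t, 2 * (n * (s t * m ^ (-(1 / (n : ℝ))))) ≤ ∑' x : Fin n → ℤ,
        ∑ i, ((u (Fin.cons t x) - u (Fin.cons t (x + Pi.single i 1))) +
          (u (Fin.cons t (x + Pi.single i 1)) - u (Fin.cons t x))) := by
      intro t
      by_cases h0 : s t = 0
      · simp [h0]
      have htop : s t ≠ ∞ := ne_top_of_le_ne_top hS (hsS t)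
      refine le_trans ?_ (ih (fun x => u (Fin.cons t x)) ?_ (fun a => h01 _) htop h0)
      · gcongr
        change _ ≤ (s t) ^ (1 - 1 / (n : ℝ))
        rw [sub_eq_add_neg, ENNReal.rpow_add _ _ h0 htop, ENNReal.rpow_one]
        refine mul_le_mul' le_rfl ?_
        rw [ENNReal.rpow_neg, ENNReal.rpow_neg]
        exact ENNReal.inv_le_inv.2 (ENNReal.rpow_le_rpow (le_iSup s t) (by positivity))
      · rintro a ⟨i, hi⟩
        exact hsupp _ ⟨i.succ, by simpa using hi⟩
    have hall := ENNReal.tsum_le_tsum hslice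
    simp_rw [ENNReal.tsum_mul_left, ENNReal.tsum_mul_right] at hall
    calc 2 * (((n + 1 : ℕ) : ℝ≥0∞) * (∑' t, s t) ^ (1 - 1 / ((n + 1 : ℕ) : ℝ)))
        ≤ 2 * (n * ((∑' t, s t) * m ^ (-(1 / (n : ℝ)))) + m) := by
          gcongr
          exact succ_mul_rpow_le n hn _ _ hS hm0 hmtop
      _ = 2 * m + 2 * (n * ((∑' t, s t) * m ^ (-(1 / (n : ℝ))))) := by ring
      _ ≤ _ := add_le_add hvert hall

lemma lpNorm_eq_norm_toLp {p : ℝ≥0∞} (hp : 1 ≤ p) {n : ℕ} (z : Fin n → ℝ) :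
    _root_.lpNorm p z = ‖WithLp.toLp p z‖ := by
  unfold _root_.lpNorm
  split_ifs with h
  · subst h
    simp [PiLp.norm_eq_ciSup]
  · have : 0 < p.toReal := ENNReal.toReal_pos (by positivity) h
    rw [PiLp.norm_eq_sum this]
    simp

section lpFacts

variable {p : ℝ≥0∞} {n : ℕ}

lemma lpNorm_nonneg' (hp : 1 ≤ p) (z : Fin n → ℝ) : 0 ≤ _root_.lpNorm p z := by
  have : Fact (1 ≤ p) := ⟨hp⟩
  rw [lpNorm_eq_norm_toLp hp]
  exact norm_nonneg _

lemma lpNorm_add_le' (hp : 1 ≤ p) (y z : Fin n → ℝ) :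
    _root_.lpNorm p (y + z) ≤ _root_.lpNorm p y + _root_.lpNorm p z := by
  have : Fact (1 ≤ p) := ⟨hp⟩
  simp only [lpNorm_eq_norm_toLp hp, WithLp.toLp_add]
  exact norm_add_le _ _

lemma lpNorm_neg' (hp : 1 ≤ p) (z : Fin n → ℝ) :
    _root_.lpNorm p (-z) = _root_.lpNorm p z := by
  have : Fact (1 ≤ p) := ⟨hp⟩
  simp only [lpNorm_eq_norm_toLp hp, WithLp.toLp_neg, norm_neg]

lemma lpNorm_zero' (hp : 1 ≤ p) : _root_.lpNorm p (0 : Fin n → ℝ) = 0 := by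
  have : Fact (1 ≤ p) := ⟨hp⟩
  simp [lpNorm_eq_norm_toLp hp]

lemma abs_apply_le_lpNorm (hp : 1 ≤ p) (z : Fin n → ℝ) (i : Fin n) :
    |z i| ≤ _root_.lpNorm p z := by
  have : Fact (1 ≤ p) := ⟨hp⟩
  rw [lpNorm_eq_norm_toLp hp]
  exact PiLp.norm_apply_le (WithLp.toLp p z) i

lemma lpNorm_single (hp : 1 ≤ p) (i : Fin n) :
    _root_.lpNorm p (Pi.single i 1 : Fin n → ℝ) = 1 := by
  have : Fact (1 ≤ p) := ⟨hp⟩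
  rw [lpNorm_eq_norm_toLp hp]
  simp

lemma measurable_lpNorm (hp : 1 ≤ p) :
    Measurable (fun z : Fin n → ℝ => _root_.lpNorm p z) := by
  have : Fact (1 ≤ p) := ⟨hp⟩
  simp only [lpNorm_eq_norm_toLp hp]
  exact ((PiLp.continuous_toLp p _).norm).measurable

lemma lpNorm_le_card_rpow_mul_norm (hp : 1 ≤ p) (z : Fin n → ℝ) :
    _root_.lpNorm p z ≤ (n : ℝ) ^ (p⁻¹).toReal * ‖z‖ := by
  by_cases h : p = ⊤
  · subst h
    rw [lpNorm_eq_norm_toLp hp, PiLp.norm_eq_ciSup]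
    simp only [inv_top, toReal_zero, Real.rpow_zero, one_mul]
    exact Real.iSup_le (fun i => norm_le_pi_norm z i) (norm_nonneg _)
  · have hp0 : 0 < p.toReal := ENNReal.toReal_pos (by positivity) h
    rw [lpNorm_eq_norm_toLp hp, PiLp.norm_eq_sum hp0, ENNReal.toReal_inv]
    have h1 : ∑ i, ‖z i‖ ^ p.toReal ≤ n * ‖z‖ ^ p.toReal := by
      calc _ ≤ ∑ _i : Fin n, ‖z‖ ^ p.toReal := by
            gcongr with i
            exact norm_le_pi_norm z i
        _ = _ := by simp
    calc _ ≤ (n * ‖z‖ ^ p.toReal) ^ (1 / p.toReal) := by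
          gcongr
      _ = _ := by
          rw [Real.mul_rpow (by positivity) (by positivity), one_div,
            Real.rpow_rpow_inv (norm_nonneg _) hp0.ne']

lemma volume_lpNorm_lt (hp : 1 ≤ p) (hn : 0 < n) {s : ℝ} (hs : 0 < s) :
    volume {z : Fin n → ℝ | _root_.lpNorm p z < s} =
      ENNReal.ofReal (unitBallVolume p n * s ^ n) := by
  have : Nonempty (Fin n) := ⟨⟨0, hn⟩⟩
  by_cases h : p = ⊤
  · subst h
    have : {z : Fin n → ℝ | _root_.lpNorm ⊤ z < s} = Metric.ball 0 s := by
      ext z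
      rw [Set.mem_ofPred_eq, lpNorm_eq_norm_toLp hp, PiLp.norm_eq_ciSup, mem_ball_zero_iff]
      simp only
      rw [Pi.norm_def, ← Finset.sup'_eq_sup Finset.univ_nonempty]
      rw [show (⨆ i, ‖z i‖) =
        ((Finset.univ.sup' Finset.univ_nonempty fun i => ‖z i‖₊ : NNReal) : ℝ) from ?_]
      apply le_antisymm
      · exact ciSup_le fun i => by
          have : ‖z i‖₊ ≤ Finset.univ.sup' Finset.univ_nonempty fun i => ‖z i‖₊ :=
            Finset.le_sup' (fun i => ‖z i‖₊) (Finset.mem_univ i)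
          exact_mod_cast this
      · obtain ⟨i, -, hi⟩ := Finset.exists_mem_eq_sup' Finset.univ_nonempty fun i => ‖z i‖₊
        rw [hi]
        exact le_ciSup (f := fun i => ‖z i‖) (Finite.bddAbove_range _) i
    rw [this, Real.volume_pi_ball _ hs]
    simp [unitBallVolume, mul_pow]
  · have hp0 : 0 < p.toReal := ENNReal.toReal_pos (by positivity) h
    have hp1 : 1 ≤ p.toReal := by
      simpa using ENNReal.toReal_mono h hp
    have := volume_sum_rpow_lt (Fin n) hp1 s
    simp only [_root_.lpNorm, h, if_false]
    rw [this, ← ENNReal.ofReal_pow hs.le, ← ENNReal.ofReal_mul (by positivity)]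
    congr 1
    simp only [unitBallVolume, Fintype.card_fin, ENNReal.toReal_inv, mul_pow, div_eq_mul_inv]
    rw [one_mul, add_comm (p.toReal⁻¹) 1, add_comm ((n : ℝ) * _) 1]
    ring

lemma unitBallVolume_pos (p : ℝ≥0∞) (n : ℕ) : 0 < unitBallVolume p n := by
  unfold unitBallVolume
  have h : 0 ≤ (p⁻¹).toReal := ENNReal.toReal_nonneg
  have h1 := Real.Gamma_pos_of_pos (show 0 < 1 + (p⁻¹).toReal by positivity)
  have h2 := Real.Gamma_pos_of_pos (show 0 < 1 + n * (p⁻¹).toReal by positivity)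
  positivity

/-- The cost `‖z‖_p^q` restricted to the integer lattice. -/
def latticeCost (p : ℝ≥0∞) (q : ℝ) {n : ℕ} (z : Fin n → ℤ) : ℝ :=
  _root_.lpNorm p (fun i => (z i : ℝ)) ^ q

variable {q : ℝ}

lemma latticeCost_nonneg (hp : 1 ≤ p) (z : Fin n → ℤ) : 0 ≤ latticeCost p q z :=
  Real.rpow_nonneg (lpNorm_nonneg' hp _) _

lemma latticeCost_zero (hp : 1 ≤ p) (hq : q ≠ 0) : latticeCost p q (0 : Fin n → ℤ) = 0 := by
  unfold latticeCost
  have : (fun i => (((0 : Fin n → ℤ) i : ℤ) : ℝ)) = 0 := by ext; simp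
  rw [this, lpNorm_zero' hp, Real.zero_rpow hq]

lemma one_le_lpNorm_intCast (hp : 1 ≤ p) {z : Fin n → ℤ} (hz : z ≠ 0) :
    1 ≤ _root_.lpNorm p (fun i => (z i : ℝ)) := by
  obtain ⟨i, hi⟩ := Function.ne_iff.1 hz
  refine le_trans ?_ (abs_apply_le_lpNorm hp _ i)
  have : 1 ≤ |z i| := Int.one_le_abs hi
  exact_mod_cast this

lemma one_le_latticeCost (hp : 1 ≤ p) (hq : 0 < q) {z : Fin n → ℤ} (hz : z ≠ 0) :
    1 ≤ latticeCost p q z :=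
  Real.one_le_rpow (one_le_lpNorm_intCast hp hz) hq.le

lemma lpNorm_rpow_add_le (hp : 1 ≤ p) (hq : 0 < q) (hq1 : q < 1) (y z : Fin n → ℝ) :
    _root_.lpNorm p (y + z) ^ q ≤ _root_.lpNorm p y ^ q + _root_.lpNorm p z ^ q :=
  (Real.rpow_le_rpow (lpNorm_nonneg' hp _) (lpNorm_add_le' hp y z) hq.le).trans
    (Real.rpow_add_le_add_rpow (lpNorm_nonneg' hp _) (lpNorm_nonneg' hp _) hq.le hq1.le)

lemma latticeCost_add_le (hp : 1 ≤ p) (hq : 0 < q) (hq1 : q < 1) (y z : Fin n → ℤ) :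
    latticeCost p q (y + z) ≤ latticeCost p q y + latticeCost p q z := by
  unfold latticeCost
  convert lpNorm_rpow_add_le hp hq hq1 (fun i => (y i : ℝ)) (fun i => (z i : ℝ)) using 3
  ext i
  simp

lemma latticeCost_neg (hp : 1 ≤ p) (z : Fin n → ℤ) :
    latticeCost p q (-z) = latticeCost p q z := by
  unfold latticeCost
  rw [← lpNorm_neg' hp]
  congr 2
  ext i
  simp

lemma latticeCost_single (hp : 1 ≤ p) (i : Fin n) :
    latticeCost p q (Pi.single i 1) = 1 := by
  unfold latticeCost
  have : (fun j => (((Pi.single i 1 : Fin n → ℤ) j : ℤ) : ℝ)) = Pi.single i 1 := by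
    ext j
    by_cases h : j = i
    · subst h; simp
    · simp [h]
  rw [this, lpNorm_single hp, Real.one_rpow]

/-- Increment bound for `‖·‖_p^q` based at a lattice point, by concavity of `t ↦ t^q`. -/
lemma lpNorm_intCast_add_rpow_le (hp : 1 ≤ p) (hq : 0 < q) (hq1 : q < 1)
    (z : Fin n → ℤ) (u : Fin n → ℝ) :
    _root_.lpNorm p ((fun i => (z i : ℝ)) + u) ^ q
      ≤ latticeCost p q z + (1 + q * _root_.lpNorm p u) := by
  have hu := lpNorm_nonneg' hp u
  have key : ∀ s : ℝ, 0 ≤ s → (1 + s) ^ q ≤ 1 + q * s := fun s hs =>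
    rpow_one_add_le_one_add_mul_self (by linarith) hq.le hq1.le
  by_cases hz : z = 0
  · subst hz
    rw [latticeCost_zero hp hq.ne']
    have : (fun i => (((0 : Fin n → ℤ) i : ℤ) : ℝ)) + u = u := by ext; simp
    rw [this, zero_add]
    exact (Real.rpow_le_rpow hu (by linarith) hq.le).trans (key _ hu)
  · have h1 := one_le_lpNorm_intCast hp hz
    set a := _root_.lpNorm p (fun i => (z i : ℝ)) with ha
    have ha0 : 0 < a := by linarith
    have h2 : _root_.lpNorm p ((fun i => (z i : ℝ)) + u) ≤ a * (1 + _root_.lpNorm p u / a) := by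
      rw [mul_add, mul_one, mul_div_cancel₀ _ ha0.ne']
      exact lpNorm_add_le' hp _ _
    have h3 : _root_.lpNorm p ((fun i => (z i : ℝ)) + u) ^ q ≤
        a ^ q * (1 + q * (_root_.lpNorm p u / a)) := by
      refine (Real.rpow_le_rpow (lpNorm_nonneg' hp _) h2 hq.le).trans ?_
      rw [Real.mul_rpow ha0.le (by positivity)]
      gcongr
      exact key _ (by positivity)
    have h4 : a ^ q ≤ a := by
      simpa using Real.rpow_le_rpow_of_exponent_le h1 hq1.le
    have h5 : a ^ q * (q * (_root_.lpNorm p u / a)) ≤ q * _root_.lpNorm p u := by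
      calc _ ≤ a * (q * (_root_.lpNorm p u / a)) := by gcongr
        _ = _ := by field_simp
    have h6 : latticeCost p q z = a ^ q := rfl
    rw [h6]
    nlinarith

end lpFacts

lemma lintegral_ofReal_sub_rpow {n : ℕ} {f : (Fin n → ℝ) → ℝ} (hf : Measurable f)
    (hf0 : ∀ z, 0 ≤ f z) {V : ℝ} (hV : 0 ≤ V)
    (hvol : ∀ s : ℝ, 0 < s → volume {z | f z < s} = ENNReal.ofReal (V * s ^ n))
    {r : ℝ} (hr : 0 < r) {ρ : ℝ} (hρ : 0 ≤ ρ) :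
    ∫⁻ z, ENNReal.ofReal (ρ - f z ^ r) =
      ENNReal.ofReal (V * ρ ^ ((n : ℝ) / r + 1) / ((n : ℝ) / r + 1)) := by
  have hN : (0 : ℝ) ≤ (n : ℝ) / r := by positivity
  have h1 : ∫⁻ z, ENNReal.ofReal (ρ - f z ^ r) = ∫⁻ z, ENNReal.ofReal (max (ρ - f z ^ r) 0) := by
    simp
  have hmeas : Measurable fun z => max (ρ - f z ^ r) 0 := by fun_prop
  rw [h1, lintegral_eq_lintegral_meas_lt (f := fun z => max (ρ - f z ^ r) 0) _
    (Filter.Eventually.of_forall fun z => le_max_right _ _)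
    hmeas.aemeasurable]
  have h2 : ∀ t ∈ Set.Ioi (0 : ℝ), volume {z | t < max (ρ - f z ^ r) 0} =
      (Set.Iio ρ).indicator (fun t => ENNReal.ofReal (V * (ρ - t) ^ ((n : ℝ) / r))) t := by
    intro t ht
    rw [Set.mem_Ioi] at ht
    by_cases htρ : t < ρ
    · rw [Set.indicator_of_mem (Set.mem_Iio.2 htρ)]
      have hpos : 0 < ρ - t := sub_pos.2 htρ
      have : {z | t < max (ρ - f z ^ r) 0} = {z | f z < (ρ - t) ^ (r⁻¹)} := by
        ext z
        simp only [Set.mem_ofPred_eq, lt_max_iff, ht.not_gt, or_false]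
        rw [Real.lt_rpow_inv_iff_of_pos (hf0 z) hpos.le hr]
        constructor <;> intro h <;> linarith
      rw [this, hvol _ (Real.rpow_pos_of_pos hpos _), ← Real.rpow_natCast, ← Real.rpow_mul hpos.le]
      congr 3
      field_simp
    · rw [Set.indicator_of_notMem (by simpa using htρ)]
      convert measure_empty (μ := (volume : Measure (Fin n → ℝ))) using 2
      ext z
      simp only [Set.mem_ofPred_eq, lt_max_iff, ht.not_gt, or_false, Set.mem_empty_iff_false,
        iff_false, not_lt]
      have := Real.rpow_nonneg (hf0 z) r
      linarith
  rw [setLIntegral_congr_fun measurableSet_Ioi h2, lintegral_indicator measurableSet_Iio,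
    Measure.restrict_restrict measurableSet_Iio, Set.inter_comm, Set.Ioi_inter_Iio,
    Measure.restrict_congr_set Ioo_ae_eq_Ioc]
  have hI : IntervalIntegrable (fun t => V * (ρ - t) ^ ((n : ℝ) / r)) volume 0 ρ := by
    apply Continuous.intervalIntegrable
    exact continuous_const.mul ((continuous_const.sub continuous_id).rpow_const fun _ => Or.inr hN)
  rw [← ofReal_integral_eq_lintegral_ofReal, ← intervalIntegral.integral_of_le hρ]
  · congr 1
    rw [intervalIntegral.integral_const_mul,
      intervalIntegral.integral_comp_sub_left (fun t => t ^ ((n : ℝ) / r)),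
      integral_rpow (Or.inl (by linarith))]
    simp only [sub_self, sub_zero]
    rw [Real.zero_rpow (by linarith)]
    ring
  · exact (intervalIntegrable_iff_integrableOn_Ioc_of_le hρ).1 hI
  · refine (ae_restrict_iff' measurableSet_Ioc).2 (Filter.Eventually.of_forall fun t ht => ?_)
    have : 0 ≤ ρ - t := sub_nonneg.2 ht.2
    positivity

/-- The half-open unit cube centred at `z`. -/
def unitCell {n : ℕ} (z : Fin n → ℝ) : Set (Fin n → ℝ) :=
  Set.pi Set.univ fun i => Set.Ico (z i - 1 / 2) (z i + 1 / 2)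

lemma mem_unitCell {n : ℕ} {z u : Fin n → ℝ} :
    u ∈ unitCell z ↔ ∀ i, z i - 1 / 2 ≤ u i ∧ u i < z i + 1 / 2 := by
  simp [unitCell]

lemma measurableSet_unitCell {n : ℕ} (z : Fin n → ℝ) : MeasurableSet (unitCell z) :=
  MeasurableSet.univ_pi fun _ => measurableSet_Ico

lemma volume_unitCell {n : ℕ} (z : Fin n → ℝ) : volume (unitCell z) = 1 := by
  rw [unitCell, volume_pi_pi]
  simp only [Real.volume_Ico]
  refine Finset.prod_eq_one fun i _ => ?_
  rw [ENNReal.ofReal_eq_one]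
  ring

lemma norm_le_of_mem_unitCell {n : ℕ} {u : Fin n → ℝ} (hu : u ∈ unitCell 0) : ‖u‖ ≤ 1 / 2 := by
  rw [pi_norm_le_iff_of_nonneg (by norm_num)]
  intro i
  have := mem_unitCell.1 hu i
  simp only [Pi.zero_apply] at this
  rw [Real.norm_eq_abs, abs_le]
  constructor <;> linarith

lemma mem_unitCell_of_norm_lt {n : ℕ} {u : Fin n → ℝ} (hu : ‖u‖ < 1 / 2) : u ∈ unitCell 0 := by
  rw [mem_unitCell]
  intro i
  have := (norm_le_pi_norm u i).trans_lt hu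
  rw [Real.norm_eq_abs, abs_lt] at this
  simp only [Pi.zero_apply]
  constructor <;> linarith

lemma setLIntegral_unitCell_norm_rpow {n : ℕ} (hn : 0 < n) {r : ℝ} (hr : 0 < r) :
    ∫⁻ u in unitCell (0 : Fin n → ℝ), ENNReal.ofReal (‖u‖ ^ r) =
      ENNReal.ofReal ((2 : ℝ) ^ (-r) * (n / (n + r))) := by
  have hn' : (0 : ℝ) < n := by exact_mod_cast hn
  have h2r : (0 : ℝ) < (2 : ℝ) ^ (-r) := by positivity
  have hhalf : (2 : ℝ) ^ (-r) = (1 / 2 : ℝ) ^ r := by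
    rw [Real.rpow_neg (by norm_num), one_div, Real.inv_rpow (by norm_num)]
  have hA : ∫⁻ u in unitCell (0 : Fin n → ℝ), ENNReal.ofReal ((2 : ℝ) ^ (-r) - ‖u‖ ^ r) =
      ENNReal.ofReal ((2 : ℝ) ^ (-r) * (r / (n + r))) := by
    rw [setLIntegral_eq_of_support_subset]
    · rw [lintegral_ofReal_sub_rpow (f := fun u : Fin n → ℝ => ‖u‖) measurable_norm
        (fun _ => norm_nonneg _) (V := 2 ^ n) (by positivity) ?_ hr h2r.le]
      · congr 1
        rw [Real.rpow_add h2r, Real.rpow_one, ← Real.rpow_mul (by norm_num),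
          show -r * (n / r) = -(n : ℝ) by field_simp, Real.rpow_neg (by norm_num),
          Real.rpow_natCast]
        field_simp
      · intro s hs
        have := Real.volume_pi_ball (0 : Fin n → ℝ) hs
        rw [Fintype.card_fin, mul_pow] at this
        rw [← this]
        congr 1
        ext; simp
    · intro u hu
      rw [Function.mem_support, ne_eq, ENNReal.ofReal_eq_zero, not_le, hhalf, sub_pos] at hu
      exact mem_unitCell_of_norm_lt ((Real.rpow_lt_rpow_iff (norm_nonneg _) (by norm_num) hr).1 hu)
  have hB : (∫⁻ u in unitCell (0 : Fin n → ℝ), ENNReal.ofReal ((2 : ℝ) ^ (-r) - ‖u‖ ^ r)) +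
      ∫⁻ u in unitCell (0 : Fin n → ℝ), ENNReal.ofReal (‖u‖ ^ r) = ENNReal.ofReal ((2 : ℝ) ^ (-r)) := by
    rw [← lintegral_add_left (by fun_prop)]
    calc _ = ∫⁻ u in unitCell (0 : Fin n → ℝ), ENNReal.ofReal ((2 : ℝ) ^ (-r)) := by
          refine setLIntegral_congr_fun (measurableSet_unitCell _) fun u hu => ?_
          have : ‖u‖ ^ r ≤ (1 / 2 : ℝ) ^ r :=
            Real.rpow_le_rpow (norm_nonneg _) (norm_le_of_mem_unitCell hu) hr.le
          rw [← ENNReal.ofReal_add (by rw [hhalf]; linarith) (by positivity), sub_add_cancel]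
      _ = _ := by simp [volume_unitCell]
  rw [hA] at hB
  have hC : ENNReal.ofReal ((2 : ℝ) ^ (-r)) = ENNReal.ofReal ((2 : ℝ) ^ (-r) * (r / (n + r))) +
      ENNReal.ofReal ((2 : ℝ) ^ (-r) * (n / (n + r))) := by
    rw [← ENNReal.ofReal_add (by positivity) (by positivity)]
    congr 1
    field_simp
    ring
  rw [hC] at hB
  exact (ENNReal.add_right_inj ENNReal.ofReal_ne_top).1 hB

section cells

variable {p : ℝ≥0∞} {n : ℕ} {q : ℝ}

/-- Averaging the cost over a unit cell increases it by at most `corr`. -/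
def IsCellCorrection (p : ℝ≥0∞) (q : ℝ) (n : ℕ) (corr : ℝ) : Prop :=
  ∀ z : Fin n → ℤ, ∫⁻ u in unitCell (0 : Fin n → ℝ),
    ENNReal.ofReal (_root_.lpNorm p ((fun i => (z i : ℝ)) + u) ^ q)
      ≤ ENNReal.ofReal (latticeCost p q z + corr)

lemma isCellCorrection_subadditive (hp : 1 ≤ p) (hq : 0 < q) (hq1 : q < 1) (hn : 0 < n) :
    IsCellCorrection p q n ((2 : ℝ) ^ (-q) * (n : ℝ) ^ (q * (p⁻¹).toReal + 1) / ((n : ℝ) + q)) := by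
  intro z
  have hn' : (0 : ℝ) < n := by exact_mod_cast hn
  have hz := latticeCost_nonneg (q := q) hp z
  calc _ ≤ ∫⁻ u in unitCell (0 : Fin n → ℝ), (ENNReal.ofReal (latticeCost p q z) +
        ENNReal.ofReal ((n : ℝ) ^ (q * (p⁻¹).toReal)) * ENNReal.ofReal (‖u‖ ^ q)) := by
        refine lintegral_mono fun u => ?_
        rw [← ENNReal.ofReal_mul (by positivity), ← ENNReal.ofReal_add hz (by positivity)]
        refine ENNReal.ofReal_le_ofReal ((lpNorm_rpow_add_le hp hq hq1 _ _).trans ?_)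
        refine add_le_add le_rfl ?_
        have := Real.rpow_le_rpow (lpNorm_nonneg' hp _) (lpNorm_le_card_rpow_mul_norm hp u) hq.le
        rwa [Real.mul_rpow (by positivity) (norm_nonneg _), ← Real.rpow_mul hn'.le, mul_comm _ q] at this
    _ = _ := by
        rw [lintegral_add_left measurable_const, lintegral_const_mul _ (by fun_prop),
          setLIntegral_unitCell_norm_rpow hn hq, lintegral_const, Measure.restrict_apply_univ,
          volume_unitCell, mul_one, ← ENNReal.ofReal_mul (by positivity),
          ← ENNReal.ofReal_add hz (by positivity)]
        congr 2
        rw [Real.rpow_add hn', Real.rpow_one]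
        ring

lemma isCellCorrection_concave (hp : 1 ≤ p) (hq : 0 < q) (hq1 : q < 1) (hn : 0 < n) :
    IsCellCorrection p q n (1 + q * (n : ℝ) ^ ((p⁻¹).toReal + 1) / (2 * ((n : ℝ) + 1))) := by
  intro z
  have hn' : (0 : ℝ) < n := by exact_mod_cast hn
  have hz := latticeCost_nonneg (q := q) hp z
  calc _ ≤ ∫⁻ u in unitCell (0 : Fin n → ℝ), (ENNReal.ofReal (latticeCost p q z + 1) +
        ENNReal.ofReal (q * (n : ℝ) ^ ((p⁻¹).toReal)) * ENNReal.ofReal (‖u‖ ^ (1 : ℝ))) := by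
        refine lintegral_mono fun u => ?_
        rw [← ENNReal.ofReal_mul (by positivity), ← ENNReal.ofReal_add (by positivity) (by positivity)]
        refine ENNReal.ofReal_le_ofReal ((lpNorm_intCast_add_rpow_le hp hq hq1 _ _).trans ?_)
        have := lpNorm_le_card_rpow_mul_norm hp u
        rw [Real.rpow_one]
        nlinarith
    _ = _ := by
        rw [lintegral_add_left measurable_const, lintegral_const_mul _ (by fun_prop),
          setLIntegral_unitCell_norm_rpow hn one_pos, lintegral_const, Measure.restrict_apply_univ,
          volume_unitCell, mul_one, ← ENNReal.ofReal_mul (by positivity),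
          ← ENNReal.ofReal_add (by positivity) (by positivity), add_assoc]
        congr 3
        rw [Real.rpow_add hn', Real.rpow_one, Real.rpow_neg_one]
        field_simp

lemma ofReal_sub_latticeCost_le_setLIntegral (hp : 1 ≤ p) {corr : ℝ} (hcorr0 : 0 ≤ corr)
    (hcorr : IsCellCorrection p q n corr) (ρ : ℝ) (z : Fin n → ℤ) :
    ENNReal.ofReal (ρ - corr - latticeCost p q z) ≤
      ∫⁻ v in unitCell (fun i => (z i : ℝ)), ENNReal.ofReal (ρ - _root_.lpNorm p v ^ q) := by
  have hm := measurable_lpNorm (n := n) hp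
  have hz := latticeCost_nonneg (q := q) hp z
  have h1 : ∫⁻ v in unitCell (fun i => (z i : ℝ)), ENNReal.ofReal (ρ - _root_.lpNorm p v ^ q) =
      ∫⁻ u in unitCell (0 : Fin n → ℝ),
        ENNReal.ofReal (ρ - _root_.lpNorm p ((fun i => (z i : ℝ)) + u) ^ q) := by
    rw [← lintegral_indicator (measurableSet_unitCell _), ← lintegral_indicator (measurableSet_unitCell _),
      ← lintegral_add_left_eq_self _ (fun i => (z i : ℝ))]
    congr 1
    ext u
    simp only [Set.indicator]
    congr 1
    simp only [mem_unitCell, Pi.add_apply, Pi.zero_apply, eq_iff_iff]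
    refine forall_congr' fun i => ?_
    constructor <;> rintro ⟨h, h'⟩ <;> constructor <;> linarith
  rw [h1, sub_sub, ENNReal.ofReal_sub _ (by positivity), tsub_le_iff_right, add_comm corr]
  calc ENNReal.ofReal ρ = ∫⁻ u in unitCell (0 : Fin n → ℝ), ENNReal.ofReal ρ := by
        simp [volume_unitCell]
    _ ≤ ∫⁻ u in unitCell (0 : Fin n → ℝ),
        (ENNReal.ofReal (ρ - _root_.lpNorm p ((fun i => (z i : ℝ)) + u) ^ q) +
          ENNReal.ofReal (_root_.lpNorm p ((fun i => (z i : ℝ)) + u) ^ q)) := by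
        refine lintegral_mono fun u => ?_
        refine le_trans (le_of_eq ?_) ENNReal.ofReal_add_le
        rw [sub_add_cancel]
    _ ≤ _ := by
        rw [lintegral_add_right _ (by fun_prop)]
        gcongr
        exact hcorr z

lemma sum_ofReal_sub_latticeCost_le (hp : 1 ≤ p) (hq : 0 < q) (hn : 0 < n) {corr : ℝ}
    (hcorr0 : 0 ≤ corr) (hcorr : IsCellCorrection p q n corr) {ρ : ℝ} (hρ : 0 ≤ ρ)
    (F : Finset (Fin n → ℤ)) :
    ∑ z ∈ F, ENNReal.ofReal (ρ - corr - latticeCost p q z) ≤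
      ENNReal.ofReal (unitBallVolume p n * ρ ^ ((n : ℝ) / q + 1) / ((n : ℝ) / q + 1)) := by
  rw [← lintegral_ofReal_sub_rpow (measurable_lpNorm (n := n) hp) (fun z => lpNorm_nonneg' hp z)
    (unitBallVolume_pos p n).le (fun s hs => volume_lpNorm_lt hp hn hs) hq hρ]
  calc _ ≤ ∑ z ∈ F, ∫⁻ v in unitCell (fun i => (z i : ℝ)), ENNReal.ofReal (ρ - _root_.lpNorm p v ^ q) :=
        Finset.sum_le_sum fun z _ => ofReal_sub_latticeCost_le_setLIntegral hp hcorr0 hcorr ρ z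
    _ = ∫⁻ v in ⋃ z ∈ F, unitCell (fun i => (z i : ℝ)), ENNReal.ofReal (ρ - _root_.lpNorm p v ^ q) := by
        rw [lintegral_biUnion_finset]
        · intro y _ z _ hyz
          rw [Function.onFun, Set.disjoint_left]
          intro v hv hv'
          apply hyz
          ext i
          have h1 := mem_unitCell.1 hv i
          have h2 := mem_unitCell.1 hv' i
          have h3 : (y i : ℝ) < z i + 1 := by linarith
          have h4 : (z i : ℝ) < y i + 1 := by linarith
          norm_cast at h3 h4
          omega
        · exact fun z _ => measurableSet_unitCell _
    _ ≤ _ := setLIntegral_le_lintegral _ _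

end cells

/-- Coordinatewise embedding of the integer lattice. -/
def latticeCast {n : ℕ} (z : Fin n → ℤ) : Fin n → ℝ := fun i => (z i : ℝ)

/-- Coordinatewise floor. -/
def latticeFloor {n : ℕ} (x : Fin n → ℝ) : Fin n → ℤ := fun i => ⌊x i⌋

lemma latticeFloor_latticeCast {n : ℕ} (z : Fin n → ℤ) : latticeFloor (latticeCast z) = z := by
  ext i
  simp [latticeFloor, latticeCast]

lemma measurable_latticeFloor {n : ℕ} : Measurable (latticeFloor (n := n)) :=
  measurable_pi_lambda _ fun i => Int.measurable_floor.comp (measurable_pi_apply i)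

/-- The uniform distribution on a finite set of lattice points. -/
def uniformLattice {n : ℕ} (S : Finset (Fin n → ℤ)) : Measure (Fin n → ℝ) :=
  ∑ y ∈ S, (S.card : ℝ≥0∞)⁻¹ • Measure.dirac (latticeCast y)

lemma lintegral_uniformLattice {n : ℕ} (S : Finset (Fin n → ℤ)) (F : (Fin n → ℝ) → ℝ≥0∞) :
    ∫⁻ x, F x ∂uniformLattice S = ∑ y ∈ S, (S.card : ℝ≥0∞)⁻¹ * F (latticeCast y) := by
  simp [uniformLattice]

lemma isProbabilityMeasure_uniformLattice {n : ℕ} {S : Finset (Fin n → ℤ)} (hS : S.Nonempty) :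
    IsProbabilityMeasure (uniformLattice S) := by
  constructor
  have := lintegral_uniformLattice S 1
  simp only [Pi.one_apply, lintegral_one, mul_one, Finset.sum_const, nsmul_eq_mul] at this
  rw [this]
  exact ENNReal.mul_inv_cancel (by simpa using hS.ne_empty) (by simp)

lemma mem_erase_iff_swap_mem_erase {α : Type*} [DecidableEq α] {G : Finset α} {a b : α}
    (ha : a ∈ G) (hb : b ∈ G) (z : α) : z ∈ G.erase a ↔ Equiv.swap a b z ∈ G.erase b := by
  rw [Finset.mem_erase, Finset.mem_erase]
  have h1 : Equiv.swap a b z = b ↔ z = a := by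
    rw [Equiv.swap_apply_eq_iff, Equiv.swap_apply_right]
  have h2 : Equiv.swap a b z ∈ G ↔ z ∈ G := by
    rcases eq_or_ne z a with rfl | hza
    · simp [ha, hb]
    · rcases eq_or_ne z b with rfl | hzb
      · simp [ha, hb]
      · rw [Equiv.swap_apply_of_ne_of_ne hza hzb]
  rw [ne_eq, ne_eq, h1, h2]

section transport

variable {p : ℝ≥0∞} {q : ℝ} {n : ℕ}

lemma lpNorm_latticeCast_sub_rpow (y z : Fin n → ℤ) :
    _root_.lpNorm p (latticeCast y - latticeCast z) ^ q = latticeCost p q (y - z) := by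
  unfold latticeCost
  congr 2
  ext i
  simp [latticeCast]

lemma Cstar_uniformLattice_erase_le (hp : 1 ≤ p) (hq : 0 < q)
    {G : Finset (Fin n → ℤ)} {a b : Fin n → ℤ} (ha : a ∈ G) (hb : b ∈ G)
    (hG : 2 ≤ G.card) :
    Cstar (fun x y : Fin n → ℝ => _root_.lpNorm p (x - y) ^ q)
      (uniformLattice (G.erase a)) (uniformLattice (G.erase b)) ≤
      ((G.card - 1 : ℕ) : ℝ≥0∞)⁻¹ * ENNReal.ofReal (latticeCost p q (b - a)) := by
  set m : ℝ≥0∞ := ((G.card - 1 : ℕ) : ℝ≥0∞)⁻¹ with hm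
  have hca : (G.erase a).card = G.card - 1 := Finset.card_erase_of_mem ha
  have hcb : (G.erase b).card = G.card - 1 := Finset.card_erase_of_mem hb
  have hne : (G.erase a).Nonempty := Finset.card_pos.1 (by omega)
  set γ : Measure ((Fin n → ℝ) × (Fin n → ℝ)) :=
    ∑ z ∈ G.erase a, m • Measure.dirac (latticeCast z, latticeCast (Equiv.swap a b z)) with hγ
  have hfst : γ.map Prod.fst = uniformLattice (G.erase a) := by
    rw [hγ, Measure.map_finset_sum (by fun_prop), uniformLattice, hca]
    refine Finset.sum_congr rfl fun z _ => ?_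
    rw [Measure.map_smul, Measure.map_dirac' measurable_fst]
  have hsnd : γ.map Prod.snd = uniformLattice (G.erase b) := by
    rw [hγ, Measure.map_finset_sum (by fun_prop), uniformLattice, hcb]
    refine Finset.sum_equiv (Equiv.swap a b) (mem_erase_iff_swap_mem_erase ha hb) fun z _ => ?_
    rw [Measure.map_smul, Measure.map_dirac' measurable_snd]
  have hprob : IsProbabilityMeasure γ := by
    have := isProbabilityMeasure_uniformLattice hne
    rw [← hfst] at this
    constructor
    have h := this.measure_univ
    rwa [Measure.map_apply measurable_fst MeasurableSet.univ, Set.preimage_univ] at h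
  refine (iInf₂_le γ ⟨hprob, hfst, hsnd⟩).trans ?_
  rw [hγ, lintegral_finsetSum_measure]
  calc _ ≤ ∑ z ∈ G.erase a, (if z = b then m * ENNReal.ofReal (latticeCost p q (b - a)) else 0) := by
        refine Finset.sum_le_sum fun z hz => ?_
        rw [lintegral_smul_measure, lintegral_dirac, smul_eq_mul]
        simp only [lpNorm_latticeCast_sub_rpow]
        split_ifs with h
        · subst h
          rw [Equiv.swap_apply_right]
        · rw [Equiv.swap_apply_of_ne_of_ne (Finset.ne_of_mem_erase hz) h, sub_self]
          simp [latticeCost_zero hp hq.ne']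
    _ ≤ _ := by
        rw [Finset.sum_ite_eq']
        split_ifs <;> simp

end transport

/-- The box `{0, …, L - 1}ⁿ`. -/
def latticeBox (n L : ℕ) : Finset (Fin n → ℤ) := Fintype.piFinset fun _ => Finset.Ico 0 (L : ℤ)

/-- A slice of the box, orthogonal to the `i`-th axis, translated to height `t`. -/
def latticeFace (n L : ℕ) (i : Fin n) (t : ℤ) : Finset (Fin n → ℤ) :=
  Fintype.piFinset fun j => if j = i then {t} else Finset.Ico 0 (L : ℤ)

/-- A lattice point outside all boxes. -/
def latticeCorner (n : ℕ) : Fin n → ℤ := fun _ => -1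

/-- The retraction of the lattice collapsing the complement of the box to `latticeCorner`. -/
def boxRetract {n : ℕ} (L : ℕ) (a : Fin n → ℤ) : Fin n → ℤ :=
  if a ∈ latticeBox n L then a else latticeCorner n

lemma mem_latticeBox {n L : ℕ} {a : Fin n → ℤ} :
    a ∈ latticeBox n L ↔ ∀ i, 0 ≤ a i ∧ a i < L := by
  simp [latticeBox]

lemma card_latticeBox (n L : ℕ) : (latticeBox n L).card = L ^ n := by
  simp [latticeBox]

lemma card_latticeFace (n L : ℕ) (i : Fin n) (t : ℤ) :
    (latticeFace n L i t).card = L ^ (n - 1) := by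
  have : ∀ j : Fin n, (if j = i then ({t} : Finset ℤ) else Finset.Ico 0 (L : ℤ)).card =
      if j = i then 1 else L := by
    intro j; split_ifs <;> simp
  simp [latticeFace, this, Finset.prod_ite, Finset.filter_ne', Finset.card_erase_of_mem]

lemma latticeCorner_notMem {n : ℕ} (hn : 0 < n) (L : ℕ) : latticeCorner n ∉ latticeBox n L := by
  intro h
  have := mem_latticeBox.1 h ⟨0, hn⟩
  simp [latticeCorner] at this

section

variable {p : ℝ≥0∞} {q : ℝ} {n : ℕ}

lemma latticeCost_sub_comm (hp : 1 ≤ p) (y z : Fin n → ℤ) :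
    latticeCost p q (y - z) = latticeCost p q (z - y) := by
  rw [← latticeCost_neg hp, neg_sub]

lemma latticeCost_sub_latticeCorner_le (hp : 1 ≤ p) (hq : 0 < q) {L : ℕ} {a : Fin n → ℤ}
    (ha : a ∈ latticeBox n L) :
    latticeCost p q (a - latticeCorner n) ≤ ((n : ℝ) ^ (p⁻¹).toReal * L) ^ q := by
  unfold latticeCost
  refine Real.rpow_le_rpow (lpNorm_nonneg' hp _) ((lpNorm_le_card_rpow_mul_norm hp _).trans ?_) hq.le
  gcongr
  rw [pi_norm_le_iff_of_nonneg (by positivity)]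
  intro i
  have := mem_latticeBox.1 ha i
  simp only [Pi.sub_apply, latticeCorner, sub_neg_eq_add]
  rw [Real.norm_eq_abs, abs_le]
  have h1 : ((a i + 1 : ℤ) : ℝ) ≤ (L : ℤ) := by exact_mod_cast this.2
  have h2 : (0 : ℝ) ≤ ((a i + 1 : ℤ) : ℝ) := by exact_mod_cast (by omega)
  simp only [Int.cast_natCast] at h1
  constructor <;> linarith [(Nat.cast_nonneg L : (0 : ℝ) ≤ L)]

lemma add_single_apply_ne {a : Fin n → ℤ} {i j : Fin n} (h : j ≠ i) :
    (a + Pi.single i 1 : Fin n → ℤ) j = a j := by simp [h]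

lemma add_single_apply_self {a : Fin n → ℤ} {i : Fin n} :
    (a + Pi.single i 1 : Fin n → ℤ) i = a i + 1 := by simp

lemma mem_latticeFace {L : ℕ} {i : Fin n} {t : ℤ} {a : Fin n → ℤ} :
    a ∈ latticeFace n L i t ↔ a i = t ∧ ∀ j ≠ i, 0 ≤ a j ∧ a j < L := by
  simp only [latticeFace, Fintype.mem_piFinset]
  constructor
  · intro h
    refine ⟨by simpa using h i, fun j hj => by simpa [hj] using h j⟩
  · rintro ⟨h1, h2⟩ j
    by_cases hj : j = i
    · subst hj; simp [h1]
    · simpa [hj] using h2 j hj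

lemma latticeCost_boxRetract_edge_le (hp : 1 ≤ p) (hq : 0 < q) (L : ℕ) (a : Fin n → ℤ) (i : Fin n) :
    ENNReal.ofReal (latticeCost p q (boxRetract L (a + Pi.single i 1) - boxRetract L a)) ≤
      (if a ∈ latticeBox n L then 1 else 0) +
      ((if a ∈ latticeFace n L i (L - 1) then
          ENNReal.ofReal (((n : ℝ) ^ (p⁻¹).toReal * L) ^ q) else 0) +
        (if a ∈ latticeFace n L i (-1) then
          ENNReal.ofReal (((n : ℝ) ^ (p⁻¹).toReal * L) ^ q) else 0)) := by
  unfold boxRetract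
  by_cases ha : a ∈ latticeBox n L <;> by_cases hb : a + Pi.single i 1 ∈ latticeBox n L
  · simp only [ha, hb, if_true]
    refine le_trans ?_ le_self_add
    rw [add_sub_cancel_left, latticeCost_single hp, ENNReal.ofReal_one]
  · simp only [ha, hb, if_true, if_false]
    have hface : a ∈ latticeFace n L i (L - 1) := by
      rw [mem_latticeFace]
      have h1 := mem_latticeBox.1 ha
      refine ⟨?_, fun j _ => h1 j⟩
      by_contra hne
      apply hb
      rw [mem_latticeBox]
      intro j
      by_cases hj : j = i
      · subst hj
        rw [add_single_apply_self]
        have := h1 j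
        omega
      · rw [add_single_apply_ne hj]
        exact h1 j
    simp only [hface, if_true]
    rw [latticeCost_sub_comm hp]
    exact (ENNReal.ofReal_le_ofReal (latticeCost_sub_latticeCorner_le hp hq ha)).trans
      (le_self_add.trans le_add_self)
  · simp only [ha, hb, if_true, if_false]
    have hface : a ∈ latticeFace n L i (-1) := by
      rw [mem_latticeFace]
      have h1 := mem_latticeBox.1 hb
      have h2 : ∀ j ≠ i, 0 ≤ a j ∧ a j < L := fun j hj => by
        simpa only [add_single_apply_ne hj] using h1 j
      refine ⟨?_, h2⟩
      by_contra hne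
      apply ha
      rw [mem_latticeBox]
      intro j
      by_cases hj : j = i
      · subst hj
        have := h1 j
        rw [add_single_apply_self] at this
        omega
      · exact h2 j hj
    simp only [hface, if_true]
    exact (ENNReal.ofReal_le_ofReal (latticeCost_sub_latticeCorner_le hp hq hb)).trans
      (le_add_self.trans le_add_self)
  · simp only [ha, hb, if_false]
    simp [latticeCost_zero hp hq.ne']

lemma tsum_ite_mem {α : Type*} [DecidableEq α] (S : Finset α) (x : ℝ≥0∞) :
    ∑' a, (if a ∈ S then x else 0) = S.card * x := by
  rw [tsum_eq_sum (s := S) fun b hb => by simp [hb]]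
  simp

lemma tsum_latticeCost_boxRetract_le (hp : 1 ≤ p) (hq : 0 < q) (L : ℕ) :
    ∑' a : Fin n → ℤ, ∑ i, ENNReal.ofReal
        (latticeCost p q (boxRetract L (a + Pi.single i 1) - boxRetract L a)) ≤
      n * ((L : ℝ≥0∞) ^ n + 2 * ((L : ℝ≥0∞) ^ (n - 1) *
        ENNReal.ofReal (((n : ℝ) ^ (p⁻¹).toReal * L) ^ q))) := by
  calc _ ≤ ∑' a : Fin n → ℤ, ∑ i : Fin n, ((if a ∈ latticeBox n L then 1 else 0) +
      ((if a ∈ latticeFace n L i (L - 1) then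
          ENNReal.ofReal (((n : ℝ) ^ (p⁻¹).toReal * L) ^ q) else 0) +
        (if a ∈ latticeFace n L i (-1) then
          ENNReal.ofReal (((n : ℝ) ^ (p⁻¹).toReal * L) ^ q) else 0))) := by
        gcongr with a i
        exact latticeCost_boxRetract_edge_le hp hq L a i
    _ = ∑ i : Fin n, ∑' a : Fin n → ℤ, ((if a ∈ latticeBox n L then 1 else 0) +
      ((if a ∈ latticeFace n L i (L - 1) then
          ENNReal.ofReal (((n : ℝ) ^ (p⁻¹).toReal * L) ^ q) else 0) +
        (if a ∈ latticeFace n L i (-1) then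
          ENNReal.ofReal (((n : ℝ) ^ (p⁻¹).toReal * L) ^ q) else 0))) :=
        Summable.tsum_finsetSum fun _ _ => ENNReal.summable
    _ = _ := by
        simp only [ENNReal.tsum_add, tsum_ite_mem, card_latticeBox, card_latticeFace, mul_one,
          Finset.sum_const, Finset.card_univ, Fintype.card_fin, nsmul_eq_mul, Nat.cast_pow]
        rw [two_mul]

lemma tsub_add_tsub_le {x y w : ℝ≥0∞} (h1 : x ≤ y + w) (h2 : y ≤ x + w) :
    (x - y) + (y - x) ≤ w := by
  rcases le_total x y with h | h
  · rw [tsub_eq_zero_of_le h, zero_add, tsub_le_iff_left]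
    exact h2
  · rw [tsub_eq_zero_of_le h, add_zero, tsub_le_iff_left]
    exact h1

lemma ofReal_latticeCost_triangle (hp : 1 ≤ p) (hq : 0 < q) (hq1 : q < 1) (x y z : Fin n → ℤ) :
    ENNReal.ofReal (latticeCost p q (x - z)) ≤
      ENNReal.ofReal (latticeCost p q (y - z)) + ENNReal.ofReal (latticeCost p q (x - y)) := by
  rw [← ENNReal.ofReal_add (latticeCost_nonneg hp _) (latticeCost_nonneg hp _)]
  refine ENNReal.ofReal_le_ofReal ?_
  have := latticeCost_add_le hp hq hq1 (y - z) (x - y)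
  rwa [show y - z + (x - y) = x - z by abel] at this

/-- The isoperimetric inequality applied to the displacement costs of a map on the box. -/
lemma two_mul_rpow_le_tsum_edges (hp : 1 ≤ p) (hq : 0 < q) (hq1 : q < 1) (L : ℕ)
    (φ : (Fin n → ℤ) → (Fin n → ℤ))
    (hφ : ∃ a ∈ latticeBox n L, φ a ≠ φ (latticeCorner n)) :
    2 * (n * (∑ a ∈ latticeBox n L,
        ENNReal.ofReal (latticeCost p q (φ a - φ (latticeCorner n)))) ^ (1 - 1 / (n : ℝ))) ≤
      ∑' a, ∑ i, ENNReal.ofReal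
        (latticeCost p q (φ (boxRetract L (a + Pi.single i 1)) - φ (boxRetract L a))) := by
  set u : (Fin n → ℤ) → ℝ≥0∞ := fun a =>
    ENNReal.ofReal (latticeCost p q (φ (boxRetract L a) - φ (latticeCorner n))) with hu
  have hout : ∀ a, a ∉ latticeBox n L → u a = 0 := by
    intro a ha
    simp [hu, boxRetract, ha, latticeCost_zero hp hq.ne']
  have hin : ∀ a ∈ latticeBox n L,
      u a = ENNReal.ofReal (latticeCost p q (φ a - φ (latticeCorner n))) := by
    intro a ha
    simp [hu, boxRetract, ha]
  have hsum : ∑' a, u a = ∑ a ∈ latticeBox n L,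
      ENNReal.ofReal (latticeCost p q (φ a - φ (latticeCorner n))) := by
    rw [tsum_eq_sum fun a ha => hout a ha]
    exact Finset.sum_congr rfl hin
  have h01 : ∀ z : Fin n → ℤ, z ≠ 0 → 1 ≤ ENNReal.ofReal (latticeCost p q z) := fun z hz =>
    ENNReal.one_le_ofReal.2 (one_le_latticeCost hp hq hz)
  have hsob := discrete_sobolev n u L ?_ ?_ ?_ ?_
  · rw [hsum] at hsob
    refine hsob.trans ?_
    gcongr with a i
    refine tsub_add_tsub_le ?_ ?_
    · rw [latticeCost_sub_comm hp (φ (boxRetract L (a + Pi.single i 1)))]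
      exact ofReal_latticeCost_triangle hp hq hq1 _ _ _
    · exact ofReal_latticeCost_triangle hp hq hq1 _ _ _
  · rintro a ⟨i, hi⟩
    apply hout
    rw [mem_latticeBox]
    intro h
    have := h i
    omega
  · intro a
    by_cases h : φ (boxRetract L a) - φ (latticeCorner n) = 0
    · left
      simp [hu, h, latticeCost_zero hp hq.ne']
    · exact Or.inr (h01 _ h)
  · rw [hsum]
    exact ENNReal.sum_ne_top.2 fun _ _ => ENNReal.ofReal_ne_top
  · obtain ⟨a, ha, hne⟩ := hφ
    rw [hsum, ne_eq, Finset.sum_eq_zero_iff]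
    intro h
    have h1 := h01 _ (sub_ne_zero.2 hne)
    rw [h a ha] at h1
    simp at h1

end

lemma ae_uniformLattice {n : ℕ} (S : Finset (Fin n → ℤ)) :
    ∀ᵐ x ∂uniformLattice S, latticeFloor x ∈ S ∧ x = latticeCast (latticeFloor x) := by
  have hfin : (latticeCast '' (S : Set (Fin n → ℤ))).Finite := S.finite_toSet.image _
  have hmeas : MeasurableSet (latticeCast '' (S : Set (Fin n → ℤ)))ᶜ := hfin.measurableSet.compl
  have h0 : uniformLattice S (latticeCast '' (S : Set (Fin n → ℤ)))ᶜ = 0 := by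
    rw [← lintegral_indicator_one hmeas, lintegral_uniformLattice]
    refine Finset.sum_eq_zero fun y hy => ?_
    rw [Set.indicator_of_notMem, mul_zero]
    simpa using ⟨y, hy, rfl⟩
  rw [ae_iff]
  refine measure_mono_null (fun x hx => ?_) h0
  rintro ⟨y, hy, rfl⟩
  apply hx
  rw [latticeFloor_latticeCast]
  exact ⟨hy, rfl⟩

section

variable {p : ℝ≥0∞} {q : ℝ} {n : ℕ}

lemma tendsto_boundary_cost (hq1 : q < 1) (x : ℝ) :
    Filter.Tendsto (fun L : ℕ => ((n : ℝ) ^ x * L) ^ q / L) Filter.atTop (nhds 0) := by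
  have h1 : Filter.Tendsto (fun L : ℕ => ((n : ℝ) ^ x) ^ q * (L : ℝ) ^ (-(1 - q)))
      Filter.atTop (nhds (((n : ℝ) ^ x) ^ q * 0)) :=
    ((tendsto_rpow_neg_atTop (by linarith)).comp tendsto_natCast_atTop_atTop).const_mul _
  rw [mul_zero] at h1
  refine h1.congr' ?_
  filter_upwards [Filter.eventually_ge_atTop 1] with L hL
  have hL' : (0 : ℝ) < L := by exact_mod_cast hL
  rw [Real.mul_rpow (by positivity) hL'.le, mul_div_assoc, neg_sub, Real.rpow_sub hL', Real.rpow_one]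

/-- A system of random lattice points indexed by lattice points, `Φ a` being uniform on
`G \ {a}` for `a ∈ G`, with pairwise costs controlled by `r`. -/
structure IsLatticeCoupling (p : ℝ≥0∞) (q : ℝ) {n : ℕ} (r : ℝ≥0∞) (μ : Measure ℝ)
    (G : Finset (Fin n → ℤ)) (Φ : ℝ → (Fin n → ℤ) → (Fin n → ℤ)) : Prop where
  measurable : ∀ a, Measurable fun ω => Φ ω a
  lintegral_eq : ∀ a ∈ G, ∀ F : (Fin n → ℤ) → ℝ≥0∞,
    ∫⁻ ω, F (Φ ω a) ∂μ = ∑ y ∈ G.erase a, ((G.card - 1 : ℕ) : ℝ≥0∞)⁻¹ * F y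
  ae_mem : ∀ᵐ ω ∂μ, ∀ a, Φ ω a ∈ G.erase a
  cost_le : ∀ a ∈ G, ∀ b ∈ G,
      ∫⁻ ω, ENNReal.ofReal (latticeCost p q (Φ ω a - Φ ω b)) ∂μ ≤
        r * (((G.card - 1 : ℕ) : ℝ≥0∞)⁻¹ * ENNReal.ofReal (latticeCost p q (b - a)))

lemma exists_isLatticeCoupling (hp : 1 ≤ p) (hq : 0 < q)
    {f : ProbabilityMeasure (Fin n → ℝ) → ℝ → Fin n → ℝ}
    (hf : IsCoupling (fun P : ProbabilityMeasure (Fin n → ℝ) => (P : Measure (Fin n → ℝ))) f)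
    {r : ℝ≥0∞}
    (hr : ∀ P Q : ProbabilityMeasure (Fin n → ℝ),
      ∫⁻ u, ENNReal.ofReal (_root_.lpNorm p (f P u - f Q u) ^ q) ∂stdSpace ≤
        r * Cstar (fun x y : Fin n → ℝ => _root_.lpNorm p (x - y) ^ q) P Q)
    {G : Finset (Fin n → ℤ)} (hG : 2 ≤ G.card) :
    ∃ Φ, IsLatticeCoupling p q r stdSpace G Φ := by
  have hne : ∀ a, (G.erase a).Nonempty := fun a => by
    rw [← Finset.card_pos]
    have := Finset.pred_card_le_card_erase (s := G) (a := a)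
    omega
  obtain ⟨P, hP⟩ : ∃ P : (Fin n → ℤ) → ProbabilityMeasure (Fin n → ℝ),
      ∀ a, (P a : Measure (Fin n → ℝ)) = uniformLattice (G.erase a) :=
    ⟨fun a => ⟨uniformLattice (G.erase a), isProbabilityMeasure_uniformLattice (hne a)⟩,
      fun a => rfl⟩
  have hlaw : ∀ a, stdSpace.map (f (P a)) = uniformLattice (G.erase a) := fun a => by
    rw [← hP]
    exact hf.law (P a)
  have hae : ∀ a, ∀ᵐ ω ∂stdSpace, latticeFloor (f (P a) ω) ∈ G.erase a ∧
      f (P a) ω = latticeCast (latticeFloor (f (P a) ω)) := by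
    intro a
    have := ae_uniformLattice (G.erase a)
    rw [← hlaw] at this
    exact ae_of_ae_map (hf.measurable (P a)).aemeasurable this
  refine ⟨fun ω a => latticeFloor (f (P a) ω), fun a => ?_, fun a ha F => ?_, ?_, fun a ha b hb => ?_⟩
  · exact measurable_latticeFloor.comp (hf.measurable (P a))
  · have hFm : Measurable F := Measurable.of_discrete
    have h1 := lintegral_map (μ := stdSpace) (hFm.comp measurable_latticeFloor)
      (hf.measurable (P a))
    rw [hlaw, lintegral_uniformLattice, Finset.card_erase_of_mem ha] at h1
    simp only [Function.comp, latticeFloor_latticeCast] at h1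
    exact h1.symm
  · exact ae_all_iff.2 fun a => (hae a).mono fun ω h => h.1
  · calc _ = ∫⁻ u, ENNReal.ofReal (_root_.lpNorm p (f (P a) u - f (P b) u) ^ q) ∂stdSpace := by
          refine lintegral_congr_ae ?_
          filter_upwards [hae a, hae b] with ω h1 h2
          rw [h1.2, h2.2, lpNorm_latticeCast_sub_rpow, latticeFloor_latticeCast,
            latticeFloor_latticeCast]
      _ ≤ _ := hr (P a) (P b)
      _ ≤ _ := by
          rw [hP, hP]
          gcongr
          exact Cstar_uniformLattice_erase_le hp hq ha hb hG

lemma measurable_ofReal_latticeCost_sub {X Y : ℝ → Fin n → ℤ} (hX : Measurable X)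
    (hY : Measurable Y) : Measurable fun ω => ENNReal.ofReal (latticeCost p q (X ω - Y ω)) := by
  have : Measurable fun z : Fin n → ℤ => ENNReal.ofReal (latticeCost p q z) :=
    Measurable.of_discrete
  exact this.comp (hX.sub hY)

lemma card_insert_latticeCorner (hn : 0 < n) (L : ℕ) :
    (insert (latticeCorner n) (latticeBox n L)).card = L ^ n + 1 := by
  rw [Finset.card_insert_of_notMem (latticeCorner_notMem hn L), card_latticeBox]

lemma IsLatticeCoupling.ae_exists_ne (hn : 0 < n) {r : ℝ≥0∞} {μ : Measure ℝ} {L : ℕ}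
    {Φ : ℝ → (Fin n → ℤ) → (Fin n → ℤ)}
    (hΦ : IsLatticeCoupling p q r μ (insert (latticeCorner n) (latticeBox n L)) Φ) :
    ∀ᵐ ω ∂μ, ∃ a ∈ latticeBox n L, Φ ω a ≠ Φ ω (latticeCorner n) := by
  filter_upwards [hΦ.ae_mem] with ω hω
  have h1 := hω (latticeCorner n)
  rw [Finset.erase_insert (latticeCorner_notMem hn L)] at h1
  exact ⟨_, h1, Finset.ne_of_mem_erase (hω _)⟩

/-- The isoperimetric inequality in expectation. -/
lemma IsLatticeCoupling.two_mul_lintegral_le (hp : 1 ≤ p) (hq : 0 < q) (hq1 : q < 1) (hn : 0 < n)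
    {r : ℝ≥0∞} {μ : Measure ℝ} {L : ℕ} (hL : 0 < L) {Φ : ℝ → (Fin n → ℤ) → (Fin n → ℤ)}
    (hΦ : IsLatticeCoupling p q r μ (insert (latticeCorner n) (latticeBox n L)) Φ) :
    2 * ∫⁻ ω, (∑ a ∈ latticeBox n L, ENNReal.ofReal
        (latticeCost p q (Φ ω a - Φ ω (latticeCorner n)))) ^ (1 - 1 / (n : ℝ)) ∂μ ≤
      r * (1 + 2 * ENNReal.ofReal (((n : ℝ) ^ (p⁻¹).toReal * L) ^ q / L)) := by
  have hcm : ∀ a b, Measurable fun ω => ENNReal.ofReal (latticeCost p q (Φ ω a - Φ ω b)) :=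
    fun a b => measurable_ofReal_latticeCost_sub (hΦ.measurable a) (hΦ.measurable b)
  have hSm : Measurable fun ω => (∑ a ∈ latticeBox n L, ENNReal.ofReal
      (latticeCost p q (Φ ω a - Φ ω (latticeCorner n)))) ^ (1 - 1 / (n : ℝ)) :=
    (Finset.measurable_fun_sum _ fun a _ => hcm a _).pow_const _
  have hn0 : (n : ℝ≥0∞) ≠ 0 := by exact_mod_cast hn.ne'
  have hretract : ∀ a, boxRetract L a ∈ insert (latticeCorner n) (latticeBox n L) := fun a => by
    unfold boxRetract
    split_ifs with h
    · exact Finset.mem_insert_of_mem h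
    · exact Finset.mem_insert_self _ _
  have hcost := hΦ.cost_le
  simp only [card_insert_latticeCorner hn, Nat.add_sub_cancel, Nat.cast_pow] at hcost
  set M : ℝ≥0∞ := (L : ℝ≥0∞) ^ n with hM
  have hM0 : M ≠ 0 := by positivity
  have hMt : M ≠ ∞ := by simp [hM]
  refine (ENNReal.mul_le_mul_iff_right hn0 (by simp)).1 ?_
  calc _ = ∫⁻ ω, 2 * (n * (∑ a ∈ latticeBox n L,
        ENNReal.ofReal (latticeCost p q (Φ ω a - Φ ω (latticeCorner n)))) ^ (1 - 1 / (n : ℝ))) ∂μ := by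
        rw [lintegral_const_mul _ (hSm.const_mul _), lintegral_const_mul _ hSm]
        ring
    _ ≤ ∫⁻ ω, ∑' a, ∑ i, ENNReal.ofReal (latticeCost p q
          (Φ ω (boxRetract L (a + Pi.single i 1)) - Φ ω (boxRetract L a))) ∂μ := by
        refine lintegral_mono_ae ?_
        filter_upwards [hΦ.ae_exists_ne hn] with ω hω
        exact two_mul_rpow_le_tsum_edges hp hq hq1 L (Φ ω) hω
    _ = ∑' a : Fin n → ℤ, ∑ i, ∫⁻ ω, ENNReal.ofReal (latticeCost p q
          (Φ ω (boxRetract L (a + Pi.single i 1)) - Φ ω (boxRetract L a))) ∂μ := by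
        rw [lintegral_tsum fun a =>
          (Finset.measurable_fun_sum _ fun i _ => hcm _ _).aemeasurable]
        congr 1
        ext a
        exact lintegral_finsetSum _ fun i _ => hcm _ _
    _ ≤ ∑' a : Fin n → ℤ, ∑ i, r * (M⁻¹ * ENNReal.ofReal (latticeCost p q
          (boxRetract L (a + Pi.single i 1) - boxRetract L a))) := by
        gcongr with a i
        rw [latticeCost_sub_comm hp (boxRetract L (a + Pi.single i 1))]
        exact hcost _ (hretract _) _ (hretract _)
    _ = r * (M⁻¹ * ∑' a : Fin n → ℤ, ∑ i, ENNReal.ofReal (latticeCost p q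
          (boxRetract L (a + Pi.single i 1) - boxRetract L a))) := by
        simp only [← Finset.mul_sum, ENNReal.tsum_mul_left]
    _ ≤ r * (M⁻¹ * (n * (M + 2 * ((L : ℝ≥0∞) ^ (n - 1) *
          ENNReal.ofReal (((n : ℝ) ^ (p⁻¹).toReal * L) ^ q))))) := by
        gcongr
        exact tsum_latticeCost_boxRetract_le hp hq L
    _ = _ := by
        have hLR : (0 : ℝ) < L := by exact_mod_cast hL
        have hM' : M = (L : ℝ≥0∞) ^ (n - 1) * L := by
          rw [hM, ← pow_succ, Nat.sub_add_cancel hn]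
        have h2 : ENNReal.ofReal (((n : ℝ) ^ (p⁻¹).toReal * L) ^ q) =
            L * ENNReal.ofReal (((n : ℝ) ^ (p⁻¹).toReal * L) ^ q / L) := by
          rw [← ENNReal.ofReal_natCast L, ← ENNReal.ofReal_mul hLR.le]
          congr 1
          field_simp
        rw [h2, ← mul_assoc ((L : ℝ≥0∞) ^ (n - 1)), ← hM']
        calc _ = n * (r * ((M⁻¹ * M) * (1 + 2 *
              ENNReal.ofReal (((n : ℝ) ^ (p⁻¹).toReal * L) ^ q / L)))) := by ring
          _ = _ := by rw [ENNReal.inv_mul_cancel hM0 hMt, one_mul]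

lemma IsLatticeCoupling.apply_zero_le (hn : 0 < n) {h : (Fin n → ℤ) → ℝ≥0∞} {K : ℝ≥0∞}
    (hK : K ≠ ∞)
    (hbox : ∀ (Λ : Finset (Fin n → ℤ)) (φ : (Fin n → ℤ) → (Fin n → ℤ)) (y : Fin n → ℤ),
      (∃ a ∈ Λ, φ a ≠ y) → ∑ a ∈ Λ, h (y - a) ≤ ∑ a ∈ Λ, h (φ a - a) +
        (∑ a ∈ Λ, ENNReal.ofReal (latticeCost p q (φ a - y))) ^ (1 - 1 / (n : ℝ)))
    (hsum : ∀ (F : Finset (Fin n → ℤ)) (z : Fin n → ℤ), ∑ a ∈ F, h (z - a) ≤ K)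
    {r : ℝ≥0∞} {μ : Measure ℝ} {L : ℕ} (hL : 0 < L) {Φ : ℝ → (Fin n → ℤ) → (Fin n → ℤ)}
    (hΦ : IsLatticeCoupling p q r μ (insert (latticeCorner n) (latticeBox n L)) Φ) :
    h 0 ≤ (∫⁻ ω, (∑ a ∈ latticeBox n L, ENNReal.ofReal
        (latticeCost p q (Φ ω a - Φ ω (latticeCorner n)))) ^ (1 - 1 / (n : ℝ)) ∂μ) +
      ((L : ℝ≥0∞) ^ n)⁻¹ * K := by
  have hcm : ∀ a b, Measurable fun ω => ENNReal.ofReal (latticeCost p q (Φ ω a - Φ ω b)) :=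
    fun a b => measurable_ofReal_latticeCost_sub (hΦ.measurable a) (hΦ.measurable b)
  have hSm : Measurable fun ω => (∑ a ∈ latticeBox n L, ENNReal.ofReal
      (latticeCost p q (Φ ω a - Φ ω (latticeCorner n)))) ^ (1 - 1 / (n : ℝ)) :=
    (Finset.measurable_fun_sum _ fun a _ => hcm a _).pow_const _
  have hhm : ∀ a b, Measurable fun ω => h (Φ ω b - a) := by
    intro a b
    have : Measurable fun z : Fin n → ℤ => h (z - a) := Measurable.of_discrete
    exact this.comp (hΦ.measurable b)
  have hmove := hΦ.ae_exists_ne hn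
  have hexp := hΦ.lintegral_eq
  simp only [card_insert_latticeCorner hn, Nat.add_sub_cancel, Nat.cast_pow] at hexp
  have hMcast : ((L ^ n : ℕ) : ℝ≥0∞) = (L : ℝ≥0∞) ^ n := by simp
  have hsΛ := latticeCorner_notMem hn L
  have hcard := card_latticeBox n L
  set M : ℝ≥0∞ := (L : ℝ≥0∞) ^ n with hM
  have hM0 : M ≠ 0 := by positivity
  have hMt : M ≠ ∞ := by simp [hM]
  generalize latticeBox n L = Λ at *
  generalize latticeCorner n = s at *
  set S := ∫⁻ ω, (∑ a ∈ Λ, ENNReal.ofReal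
    (latticeCost p q (Φ ω a - Φ ω s))) ^ (1 - 1 / (n : ℝ)) ∂μ with hS
  set B := ∑ a ∈ Λ, ∑ y ∈ (insert s Λ).erase a, M⁻¹ * h (y - a) with hB
  have hBt : B ≠ ∞ := by
    refine ENNReal.sum_ne_top.2 fun a _ => ENNReal.sum_ne_top.2 fun y _ => ?_
    refine ENNReal.mul_ne_top (ENNReal.inv_ne_top.2 hM0) (ne_top_of_le_ne_top hK ?_)
    simpa using hsum {a} y
  have h1 : ∑ a ∈ Λ, ∑ y ∈ Λ, M⁻¹ * h (y - a) ≤ B + S := by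
    calc _ = ∫⁻ ω, ∑ a ∈ Λ, h (Φ ω s - a) ∂μ := by
          rw [lintegral_finsetSum _ fun a _ => hhm a s]
          refine Finset.sum_congr rfl fun a ha => ?_
          have := hexp s (Finset.mem_insert_self _ _) fun z => h (z - a)
          rw [this, Finset.erase_insert hsΛ]
      _ ≤ ∫⁻ ω, (∑ a ∈ Λ, h (Φ ω a - a) + (∑ a ∈ Λ,
            ENNReal.ofReal (latticeCost p q (Φ ω a - Φ ω s))) ^ (1 - 1 / (n : ℝ))) ∂μ := by
          refine lintegral_mono_ae ?_
          filter_upwards [hmove] with ω hω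
          exact hbox Λ (Φ ω) (Φ ω s) hω
      _ = _ := by
          rw [lintegral_add_right _ hSm, lintegral_finsetSum _ fun a _ => hhm a a]
          congr 1
          refine Finset.sum_congr rfl fun a ha => ?_
          exact hexp a (Finset.mem_insert_of_mem ha) fun z => h (z - a)
  have h2 : ∑ a ∈ Λ, ∑ y ∈ Λ, M⁻¹ * h (y - a) + M⁻¹ * ∑ a ∈ Λ, h (s - a) = B + h 0 := by
    have h3 : h 0 = ∑ a ∈ Λ, M⁻¹ * h 0 := by
      rw [Finset.sum_const, hcard, nsmul_eq_mul, hMcast, ← mul_assoc,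
        ENNReal.mul_inv_cancel hM0 hMt, one_mul]
    rw [h3, hB, Finset.mul_sum, ← Finset.sum_add_distrib, ← Finset.sum_add_distrib]
    refine Finset.sum_congr rfl fun a ha => ?_
    have h4 := Finset.sum_erase_add (insert s Λ) (fun y => M⁻¹ * h (y - a))
      (Finset.mem_insert_of_mem ha)
    rw [sub_self] at h4
    rw [h4, Finset.sum_insert hsΛ, add_comm]
  have h5 : B + h 0 ≤ B + (S + M⁻¹ * K) := by
    rw [← h2, ← add_assoc]
    gcongr
    exact hsum Λ s
  exact (ENNReal.add_le_add_iff_left hBt).1 h5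

theorem two_mul_le_lpOptRatio (hp : 1 ≤ p) (hq : 0 < q) (hq1 : q < 1) (hn : 0 < n)
    {h : (Fin n → ℤ) → ℝ≥0∞} {K : ℝ≥0∞} (hK : K ≠ ∞)
    (hbox : ∀ (Λ : Finset (Fin n → ℤ)) (φ : (Fin n → ℤ) → (Fin n → ℤ)) (y : Fin n → ℤ),
      (∃ a ∈ Λ, φ a ≠ y) → ∑ a ∈ Λ, h (y - a) ≤ ∑ a ∈ Λ, h (φ a - a) +
        (∑ a ∈ Λ, ENNReal.ofReal (latticeCost p q (φ a - y))) ^ (1 - 1 / (n : ℝ)))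
    (hsum : ∀ (F : Finset (Fin n → ℤ)) (z : Fin n → ℤ), ∑ a ∈ F, h (z - a) ≤ K) :
    2 * h 0 ≤ lpOptRatio n p q := by
  refine le_iInf₂ fun f hf => le_sInf ?_
  rintro r ⟨-, hr⟩
  by_cases hrt : r = ∞
  · simp [hrt]
  have hlim1 : Filter.Tendsto (fun L : ℕ => r * (1 + 2 *
      ENNReal.ofReal (((n : ℝ) ^ (p⁻¹).toReal * L) ^ q / L))) Filter.atTop
      (nhds (r * (1 + 2 * ENNReal.ofReal 0))) :=
    ENNReal.Tendsto.const_mul (tendsto_const_nhds.add (ENNReal.Tendsto.const_mul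
      (ENNReal.tendsto_ofReal (tendsto_boundary_cost hq1 _)) (Or.inr (by simp)))) (Or.inr hrt)
  have hlim2 : Filter.Tendsto (fun L : ℕ => 2 * (((L : ℝ≥0∞) ^ n)⁻¹ * K)) Filter.atTop
      (nhds (2 * (0 * K))) := by
    refine ENNReal.Tendsto.const_mul (ENNReal.Tendsto.mul_const ?_ (Or.inr hK)) (Or.inr (by simp))
    have h1 : Filter.Tendsto (fun L : ℕ => ((L : ℝ≥0∞)⁻¹) ^ n) Filter.atTop (nhds (0 ^ n)) :=
      ENNReal.Tendsto.pow ENNReal.tendsto_inv_nat_nhds_zero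
    rw [zero_pow hn.ne'] at h1
    simpa only [ENNReal.inv_pow] using h1
  have hlim := hlim1.add hlim2
  simp only [ENNReal.ofReal_zero, mul_zero, add_zero, mul_one, zero_mul] at hlim
  refine ge_of_tendsto hlim ?_
  filter_upwards [Filter.eventually_gt_atTop 0] with L hL
  obtain ⟨Φ, hΦ⟩ := exists_isLatticeCoupling hp hq hf hr
    (G := insert (latticeCorner n) (latticeBox n L)) (by
      rw [card_insert_latticeCorner hn]
      have := pow_pos hL n
      omega)
  calc 2 * h 0 ≤ _ := mul_le_mul_right (hΦ.apply_zero_le hn hK hbox hsum hL) 2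
    _ = _ := mul_add _ _ _
    _ ≤ _ := add_le_add_left (hΦ.two_mul_lintegral_le hp hq hq1 hn hL) _

end

/-- The weight representing `X ^ (1 - 1/n)` as a mixture of the functions `min t X`. -/
def profileWeight (n : ℕ) (t : ℝ) : ℝ := (1 - 1 / (n : ℝ)) * (1 / n) * t ^ (-1 - 1 / (n : ℝ))

lemma profileWeight_nonneg {n : ℕ} {t : ℝ} (ht : 0 ≤ t) : 0 ≤ profileWeight n t := by
  unfold profileWeight
  rcases Nat.eq_zero_or_pos n with rfl | hn
  · simp
  · have : 1 / (n : ℝ) ≤ 1 := by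
      rw [div_le_one (by exact_mod_cast hn)]
      exact_mod_cast hn
    have : 0 ≤ 1 - 1 / (n : ℝ) := by linarith
    positivity

lemma profileWeight_le_one {n : ℕ} {t : ℝ} (ht : 1 ≤ t) : profileWeight n t ≤ 1 := by
  have h0 : 0 ≤ 1 / (n : ℝ) := by positivity
  have h1 : 1 / (n : ℝ) ≤ 1 := by
    rcases Nat.eq_zero_or_pos n with rfl | hn
    · simp
    · rw [div_le_one (by exact_mod_cast hn)]
      exact_mod_cast hn
  have h2 : t ^ (-1 - 1 / (n : ℝ)) ≤ 1 := Real.rpow_le_one_of_one_le_of_nonpos ht (by linarith)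
  have h3 : 0 ≤ t ^ (-1 - 1 / (n : ℝ)) := by positivity
  unfold profileWeight
  refine mul_le_one₀ ?_ h3 h2
  exact mul_le_one₀ (by linarith) h0 h1

lemma measurable_profileWeight (n : ℕ) : Measurable (profileWeight n) := by
  unfold profileWeight
  fun_prop

lemma lintegral_profileWeight_min_le {n : ℕ} (hn : 2 ≤ n) {X : ℝ} (hX : 1 ≤ X) :
    ENNReal.ofReal (1 / n) + ∫⁻ t in Set.Ioi 1, ENNReal.ofReal (profileWeight n t) *
      min (ENNReal.ofReal t) (ENNReal.ofReal X) ≤ ENNReal.ofReal (X ^ (1 - 1 / (n : ℝ))) := by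
  have hn0 : (0 : ℝ) < n := by exact_mod_cast (by omega : 0 < n)
  have hn1 : (1 : ℝ) < n := by exact_mod_cast (by omega : 1 < n)
  have hinv : 1 / (n : ℝ) < 1 := by rw [div_lt_one hn0]; exact hn1
  have hinv0 : 0 < 1 / (n : ℝ) := by positivity
  have hX0 : 0 < X := by linarith
  have hXp : 1 ≤ X ^ (1 - 1 / (n : ℝ)) := Real.one_le_rpow hX (by linarith)
  have h1 : ∫⁻ t in Set.Ioc 1 X, ENNReal.ofReal (profileWeight n t) *
      min (ENNReal.ofReal t) (ENNReal.ofReal X) ≤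
        ENNReal.ofReal (1 / n * (X ^ (1 - 1 / (n : ℝ)) - 1)) := by
    have hI : IntervalIntegrable (fun t : ℝ => (1 - 1 / (n : ℝ)) * (1 / n) * t ^ (-(1 / (n : ℝ))))
        volume 1 X := (intervalIntegral.intervalIntegrable_rpow' (by linarith)).const_mul _
    calc _ ≤ ∫⁻ t in Set.Ioc 1 X, ENNReal.ofReal
            ((1 - 1 / (n : ℝ)) * (1 / n) * t ^ (-(1 / (n : ℝ)))) := by
          refine setLIntegral_mono' measurableSet_Ioc fun t ht => ?_
          have ht0 : 0 < t := by linarith [ht.1]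
          refine (mul_le_mul_right (min_le_left _ _) _).trans ?_
          rw [← ENNReal.ofReal_mul (profileWeight_nonneg ht0.le)]
          refine ENNReal.ofReal_le_ofReal (le_of_eq ?_)
          rw [profileWeight, show -(1 / (n : ℝ)) = (-1 - 1 / (n : ℝ)) + 1 by ring,
            Real.rpow_add ht0, Real.rpow_one]
          ring
      _ = _ := by
          rw [← ofReal_integral_eq_lintegral_ofReal
            ((intervalIntegrable_iff_integrableOn_Ioc_of_le hX).1 hI)
            ((ae_restrict_iff' measurableSet_Ioc).2 (Filter.Eventually.of_forall fun t ht => by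
              have ht0 : 0 < t := by linarith [ht.1]
              have : 0 ≤ 1 - 1 / (n : ℝ) := by linarith
              positivity)),
            ← intervalIntegral.integral_of_le hX, intervalIntegral.integral_const_mul,
            integral_rpow (Or.inl (by linarith))]
          congr 1
          rw [Real.one_rpow, show -(1 / (n : ℝ)) + 1 = 1 - 1 / n by ring]
          have : (n : ℝ) - 1 ≠ 0 := by linarith
          field_simp
  have h2 : ∫⁻ t in Set.Ioi X, ENNReal.ofReal (profileWeight n t) *
      min (ENNReal.ofReal t) (ENNReal.ofReal X) ≤
        ENNReal.ofReal ((1 - 1 / (n : ℝ)) * X ^ (1 - 1 / (n : ℝ))) := by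
    have hI : IntegrableOn (fun t : ℝ => (1 - 1 / (n : ℝ)) * (1 / n) * X * t ^ (-1 - 1 / (n : ℝ)))
        (Set.Ioi X) := (integrableOn_Ioi_rpow_of_lt (by linarith) hX0).const_mul _
    calc _ ≤ ∫⁻ t in Set.Ioi X, ENNReal.ofReal
            ((1 - 1 / (n : ℝ)) * (1 / n) * X * t ^ (-1 - 1 / (n : ℝ))) := by
          refine setLIntegral_mono' measurableSet_Ioi fun t ht => ?_
          have ht0 : 0 < t := hX0.trans ht
          refine (mul_le_mul_right (min_le_right _ _) _).trans ?_
          rw [← ENNReal.ofReal_mul (profileWeight_nonneg ht0.le)]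
          refine ENNReal.ofReal_le_ofReal (le_of_eq ?_)
          rw [profileWeight]
          ring
      _ = _ := by
          rw [← ofReal_integral_eq_lintegral_ofReal hI
            ((ae_restrict_iff' measurableSet_Ioi).2 (Filter.Eventually.of_forall fun t ht => by
              have ht0 : 0 < t := hX0.trans ht
              have : 0 ≤ 1 - 1 / (n : ℝ) := by linarith
              positivity)),
            integral_const_mul, integral_Ioi_rpow_of_lt (by linarith) hX0]
          congr 1
          rw [show -1 - 1 / (n : ℝ) + 1 = -(1 / n) by ring,
            show 1 - 1 / (n : ℝ) = -(1 / n) + 1 by ring, Real.rpow_add hX0, Real.rpow_one]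
          field_simp
  rw [← Set.Ioc_union_Ioi_eq_Ioi hX, lintegral_union measurableSet_Ioi
    (Set.disjoint_left.2 fun t ht ht' => absurd ht.2 (not_le.2 ht'))]
  refine (add_le_add le_rfl (add_le_add h1 h2)).trans (le_of_eq ?_)
  have : 0 ≤ 1 / (n : ℝ) * (X ^ (1 - 1 / (n : ℝ)) - 1) := mul_nonneg hinv0.le (by linarith)
  have h3 : 0 ≤ (1 - 1 / (n : ℝ)) * X ^ (1 - 1 / (n : ℝ)) :=
    mul_nonneg (by linarith) (by linarith)
  rw [← ENNReal.ofReal_add this h3, ← ENNReal.ofReal_add hinv0.le (by positivity)]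
  congr 1
  ring

section

variable {p : ℝ≥0∞} {q : ℝ} {n : ℕ}

lemma one_le_sum_latticeCost (hp : 1 ≤ p) (hq : 0 < q) {Λ : Finset (Fin n → ℤ)}
    {φ : (Fin n → ℤ) → (Fin n → ℤ)} {y : Fin n → ℤ} (h : ∃ a ∈ Λ, φ a ≠ y) :
    1 ≤ ∑ a ∈ Λ, ENNReal.ofReal (latticeCost p q (φ a - y)) := by
  obtain ⟨a, ha, hne⟩ := h
  refine le_trans ?_ (Finset.single_le_sum (fun _ _ => zero_le) ha)
  exact ENNReal.one_le_ofReal.2 (one_le_latticeCost hp hq (sub_ne_zero.2 hne))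

lemma sum_ite_sub_eq_zero_le (F : Finset (Fin n → ℤ)) (z : Fin n → ℤ) (x : ℝ≥0∞) :
    ∑ a ∈ F, (if z - a = 0 then x else 0) ≤ x := by
  simp only [sub_eq_zero]
  rw [Finset.sum_ite_eq]
  split_ifs <;> simp

lemma two_le_lpOptRatio (hp : 1 ≤ p) (hq : 0 < q) (hq1 : q < 1) (hn : 2 ≤ n) :
    2 ≤ lpOptRatio n p q := by
  have := two_mul_le_lpOptRatio (n := n) (h := fun v => if v = 0 then 1 else 0) (K := 1) hp hq hq1
    (by omega) (by simp) ?_ (fun F z => sum_ite_sub_eq_zero_le F z 1)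
  · simpa using this
  · intro Λ φ y h
    refine (sum_ite_sub_eq_zero_le Λ y 1).trans (le_trans ?_ le_add_self)
    have hn1 : (1 : ℝ) < n := by exact_mod_cast (by omega : 1 < n)
    refine ENNReal.one_le_rpow (one_le_sum_latticeCost hp hq h) (sub_pos.2 ?_)
    rw [div_lt_one (by linarith)]
    exact hn1

/-- The test function built from the truncated potentials `(lam t - c)₊`. -/
def truncatedProfile (p : ℝ≥0∞) (q : ℝ) {n : ℕ} (lam : ℝ → ℝ) (T : ℝ) (v : Fin n → ℤ) : ℝ≥0∞ :=
  (if v = 0 then ENNReal.ofReal (1 / n) else 0) +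
    ∫⁻ t in Set.Ioc 1 T, ENNReal.ofReal (profileWeight n t) *
      ENNReal.ofReal (lam t - latticeCost p q v)

lemma two_mul_truncatedProfile_zero_le (hp : 1 ≤ p) (hq : 0 < q) (hq1 : q < 1) (hn : 2 ≤ n)
    {lam : ℝ → ℝ} (hlam : Measurable lam) (T : ℝ)
    (hsum : ∀ t, 1 ≤ t → ∀ F : Finset (Fin n → ℤ),
      ∑ z ∈ F, ENNReal.ofReal (lam t - latticeCost p q z) ≤ ENNReal.ofReal t) :
    2 * truncatedProfile p q lam T (0 : Fin n → ℤ) ≤ lpOptRatio n p q := by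
  have hwm : Measurable fun t => ENNReal.ofReal (profileWeight n t) :=
    (measurable_profileWeight n).ennreal_ofReal
  have hgm : ∀ v : Fin n → ℤ, Measurable fun t => ENNReal.ofReal (profileWeight n t) *
      ENNReal.ofReal (lam t - latticeCost p q v) := fun v =>
    hwm.mul (hlam.sub_const _).ennreal_ofReal
  have hsum' : ∀ t, 1 ≤ t → ∀ (F : Finset (Fin n → ℤ)) (z : Fin n → ℤ),
      ∑ a ∈ F, ENNReal.ofReal (lam t - latticeCost p q (z - a)) ≤ ENNReal.ofReal t := by
    intro t ht F z
    rw [← Finset.sum_image (s := F) (g := fun a => z - a)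
      (f := fun v => ENNReal.ofReal (lam t - latticeCost p q v)) (by intro a _ b _ h; simpa using h)]
    exact hsum t ht _
  have hsplit : ∀ (F : Finset (Fin n → ℤ)) (ψ : (Fin n → ℤ) → (Fin n → ℤ)),
      ∑ a ∈ F, truncatedProfile p q lam T (ψ a - a) =
        ∑ a ∈ F, (if ψ a - a = 0 then ENNReal.ofReal (1 / n) else 0) +
        ∫⁻ t in Set.Ioc 1 T, ENNReal.ofReal (profileWeight n t) *
          ∑ a ∈ F, ENNReal.ofReal (lam t - latticeCost p q (ψ a - a)) := by
    intro F ψ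
    simp only [truncatedProfile, Finset.sum_add_distrib, Finset.mul_sum]
    rw [lintegral_finsetSum _ fun a _ => hgm _]
  set K := ENNReal.ofReal (1 / n) + ∫⁻ t in Set.Ioc 1 T, ENNReal.ofReal (profileWeight n t) *
    ENNReal.ofReal t with hK
  refine two_mul_le_lpOptRatio hp hq hq1 (by omega) (K := K) ?_ ?_ ?_
  · refine ENNReal.add_ne_top.2 ⟨ENNReal.ofReal_ne_top, ?_⟩
    refine (lt_of_le_of_lt (setLIntegral_mono (g := fun t => ENNReal.ofReal T) (by fun_prop)
      fun t ht => ?_) (?_ : ∫⁻ t in Set.Ioc 1 T, ENNReal.ofReal T < ∞)).ne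
    · rw [← ENNReal.ofReal_mul (profileWeight_nonneg (by linarith [ht.1]))]
      refine ENNReal.ofReal_le_ofReal (le_trans ?_ ht.2)
      exact mul_le_of_le_one_left (by linarith [ht.1]) (profileWeight_le_one ht.1.le)
    · simp [ENNReal.mul_lt_top_iff]
  · intro Λ φ y h
    have hX1 := one_le_sum_latticeCost hp hq h
    set X := ∑ a ∈ Λ, ENNReal.ofReal (latticeCost p q (φ a - y)) with hX
    have hXt : X ≠ ∞ := ENNReal.sum_ne_top.2 fun _ _ => ENNReal.ofReal_ne_top
    have hXr : 1 ≤ X.toReal := by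
      rw [← ENNReal.toReal_one]
      exact ENNReal.toReal_mono hXt hX1
    have hw := lintegral_profileWeight_min_le hn hXr
    rw [ENNReal.ofReal_toReal hXt, ← ENNReal.ofReal_rpow_of_pos (by linarith),
      ENNReal.ofReal_toReal hXt] at hw
    rw [hsplit Λ fun _ => y, hsplit Λ φ]
    calc _ ≤ ENNReal.ofReal (1 / n) + ∫⁻ t in Set.Ioc 1 T, (ENNReal.ofReal (profileWeight n t) *
          ∑ a ∈ Λ, ENNReal.ofReal (lam t - latticeCost p q (φ a - a)) +
            ENNReal.ofReal (profileWeight n t) * min (ENNReal.ofReal t) X) := by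
          refine add_le_add (sum_ite_sub_eq_zero_le _ _ _) ?_
          refine setLIntegral_mono' measurableSet_Ioc fun t ht => ?_
          rw [← mul_add]
          gcongr
          rw [← min_add_add_left, le_min_iff]
          refine ⟨(hsum' t ht.1.le Λ y).trans le_add_self, ?_⟩
          rw [hX, ← Finset.sum_add_distrib]
          gcongr with a _
          refine le_trans (ENNReal.ofReal_le_ofReal ?_) ENNReal.ofReal_add_le
          have := latticeCost_add_le hp hq hq1 (y - a) (φ a - y)
          rw [show y - a + (φ a - y) = φ a - a by abel] at this
          linarith
      _ = (∫⁻ t in Set.Ioc 1 T, ENNReal.ofReal (profileWeight n t) *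
            ∑ a ∈ Λ, ENNReal.ofReal (lam t - latticeCost p q (φ a - a))) +
          (ENNReal.ofReal (1 / n) + ∫⁻ t in Set.Ioc 1 T, ENNReal.ofReal (profileWeight n t) *
            min (ENNReal.ofReal t) X) := by
          rw [lintegral_add_right _ (by fun_prop)]
          ring
      _ ≤ _ := by
          refine add_le_add le_add_self (le_trans ?_ hw)
          gcongr
          exact Set.Ioc_subset_Ioi_self
  · intro F z
    rw [hsplit F fun _ => z, hK]
    refine add_le_add (sum_ite_sub_eq_zero_le _ _ _) ?_
    refine setLIntegral_mono' measurableSet_Ioc fun t ht => ?_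
    gcongr
    exact hsum' t ht.1.le F z

end

section

variable {p : ℝ≥0∞} {q : ℝ} {n : ℕ}

lemma integral_profileWeight_mul (hn : 2 ≤ n) (hq : 0 < q) (hq1 : q < 1) (B corr : ℝ) {T : ℝ}
    (hT : 1 ≤ T) :
    ENNReal.ofReal ((1 - 1 / (n : ℝ)) * ((n + q) / (n + q - n * q) * B *
        (1 - T ^ (-(1 / (n : ℝ) - 1 / (n / q + 1)))) - corr * (1 - T ^ (-(1 / (n : ℝ)))))) ≤
      ∫⁻ t in Set.Ioc 1 T, ENNReal.ofReal (profileWeight n t) *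
        ENNReal.ofReal (B * t ^ (1 / ((n : ℝ) / q + 1)) - corr) := by
  have hn0 : (0 : ℝ) < n := by exact_mod_cast (by omega : 0 < n)
  have hnq : 0 < (n : ℝ) + q - n * q := by nlinarith
  have hgap : 1 / (n : ℝ) - 1 / (n / q + 1) = (n + q - n * q) / (n * (n + q)) := by
    field_simp
  have hgap0 : 0 < 1 / (n : ℝ) - 1 / (n / q + 1) := by rw [hgap]; positivity
  set s := 1 / (n : ℝ) with hs
  set κ := 1 / ((n : ℝ) / q + 1) with hκ
  have hs0 : 0 < s := by positivity
  have hi1 : IntervalIntegrable (fun t : ℝ => (1 - s) * s * B * t ^ (κ - s - 1)) volume 1 T :=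
    (intervalIntegral.intervalIntegrable_rpow (Or.inr (by
      rw [Set.uIcc_of_le hT]; simp))).const_mul _
  have hi2 : IntervalIntegrable (fun t : ℝ => (1 - s) * s * corr * t ^ (-s - 1)) volume 1 T :=
    (intervalIntegral.intervalIntegrable_rpow (Or.inr (by
      rw [Set.uIcc_of_le hT]; simp))).const_mul _
  have hval : ∫ t in Set.Ioc 1 T, ((1 - s) * s * B * t ^ (κ - s - 1) -
      (1 - s) * s * corr * t ^ (-s - 1)) = (1 - s) * ((n + q) / (n + q - n * q) * B *
        (1 - T ^ (-(s - κ))) - corr * (1 - T ^ (-s))) := by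
    have h0 : (0 : ℝ) ∉ Set.uIcc 1 T := by rw [Set.uIcc_of_le hT]; simp
    rw [← intervalIntegral.integral_of_le hT, intervalIntegral.integral_sub hi1 hi2,
      intervalIntegral.integral_const_mul, intervalIntegral.integral_const_mul,
      integral_rpow (Or.inr ⟨by linarith, h0⟩), integral_rpow (Or.inr ⟨by linarith, h0⟩)]
    have h1 : (n + q) / (n + q - n * q) = s / (s - κ) := by
      rw [hgap, hs]
      field_simp
    rw [h1, Real.one_rpow, Real.one_rpow, show κ - s - 1 + 1 = -(s - κ) by ring,
      show -s - 1 + 1 = -s by ring]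
    field_simp
    ring
  rw [← hval]
  have hI := ((intervalIntegrable_iff_integrableOn_Ioc_of_le hT).1 (hi1.sub hi2))
  calc _ ≤ ENNReal.ofReal (∫ t in Set.Ioc 1 T, max ((1 - s) * s * B * t ^ (κ - s - 1) -
      (1 - s) * s * corr * t ^ (-s - 1)) 0) :=
        ENNReal.ofReal_le_ofReal (integral_mono hI hI.pos_part fun t => le_max_left _ _)
    _ = ∫⁻ t in Set.Ioc 1 T, ENNReal.ofReal (max ((1 - s) * s * B * t ^ (κ - s - 1) -
      (1 - s) * s * corr * t ^ (-s - 1)) 0) :=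
        ofReal_integral_eq_lintegral_ofReal hI.pos_part
          (Filter.Eventually.of_forall fun t => le_max_right _ _)
    _ ≤ _ := by
        refine setLIntegral_mono' measurableSet_Ioc fun t ht => ?_
        have ht0 : 0 < t := by linarith [ht.1]
        rw [← ENNReal.ofReal_mul (profileWeight_nonneg ht0.le)]
        simp only [ENNReal.ofReal_max, ENNReal.ofReal_zero, max_eq_left zero_le]
        refine ENNReal.ofReal_le_ofReal (le_of_eq ?_)
        rw [profileWeight, ← hs, show κ - s - 1 = (-1 - s) + κ by ring, Real.rpow_add ht0,
          show -s - 1 = -1 - s by ring]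
        ring

lemma ofReal_profile_le_lpOptRatio (hp : 1 ≤ p) (hq : 0 < q) (hq1 : q < 1) (hn : 2 ≤ n) {corr : ℝ}
    (hcorr0 : 0 ≤ corr) (hcorr : IsCellCorrection p q n corr) :
    ENNReal.ofReal (2 * (1 / n + (1 - 1 / (n : ℝ)) * ((n + q) / (n + q - n * q) *
      ((n / q + 1) / unitBallVolume p n) ^ (1 / ((n : ℝ) / q + 1)) - corr))) ≤
        lpOptRatio n p q := by
  have hn0 : (0 : ℝ) < n := by exact_mod_cast (by omega : 0 < n)
  have hn1 : (1 : ℝ) < n := by exact_mod_cast (by omega : 1 < n)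
  have hnq : 0 < (n : ℝ) + q - n * q := by nlinarith
  have hV := unitBallVolume_pos p n
  set V := unitBallVolume p n with hVdef
  set B := ((n / q + 1) / V) ^ (1 / ((n : ℝ) / q + 1)) with hB
  have hN : 0 < (n : ℝ) / q + 1 := by positivity
  have hB0 : 0 ≤ B := by positivity
  have hgap0 : 0 < 1 / (n : ℝ) - 1 / (n / q + 1) := by
    rw [show 1 / (n : ℝ) - 1 / (n / q + 1) = (n + q - n * q) / (n * (n + q)) by field_simp]
    positivity
  have hprof : ∀ T : ℝ, 1 ≤ T → ENNReal.ofReal (2 * (1 / n + (1 - 1 / (n : ℝ)) *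
      ((n + q) / (n + q - n * q) * B * (1 - T ^ (-(1 / (n : ℝ) - 1 / (n / q + 1)))) -
        corr * (1 - T ^ (-(1 / (n : ℝ))))))) ≤ lpOptRatio n p q := by
    intro T hT
    refine le_trans ?_ (two_mul_truncatedProfile_zero_le hp hq hq1 hn
      (lam := fun t => B * t ^ (1 / ((n : ℝ) / q + 1)) - corr) (by fun_prop) T ?_)
    · rw [ENNReal.ofReal_mul zero_le_two, ENNReal.ofReal_ofNat]
      gcongr
      refine ENNReal.ofReal_add_le.trans ?_
      simp only [truncatedProfile, latticeCost_zero hp hq.ne', sub_zero, if_true]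
      gcongr
      exact integral_profileWeight_mul hn hq hq1 B corr hT
    · intro t ht F
      have ht0 : 0 < t := by linarith
      have := sum_ofReal_sub_latticeCost_le hp hq (by omega) hcorr0 hcorr
        (ρ := B * t ^ (1 / ((n : ℝ) / q + 1))) (by positivity) F
      refine this.trans (ENNReal.ofReal_le_ofReal (le_of_eq ?_))
      rw [Real.mul_rpow hB0 (by positivity), hB, ← Real.rpow_mul (by positivity),
        ← Real.rpow_mul ht0.le, one_div_mul_cancel hN.ne', Real.rpow_one, Real.rpow_one, ← hVdef]
      field_simp
  have hlim : Filter.Tendsto (fun T : ℝ => ENNReal.ofReal (2 * (1 / n + (1 - 1 / (n : ℝ)) *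
      ((n + q) / (n + q - n * q) * B * (1 - T ^ (-(1 / (n : ℝ) - 1 / (n / q + 1)))) -
        corr * (1 - T ^ (-(1 / (n : ℝ)))))))) Filter.atTop
      (nhds (ENNReal.ofReal (2 * (1 / n + (1 - 1 / (n : ℝ)) *
      ((n + q) / (n + q - n * q) * B * (1 - 0) - corr * (1 - 0)))))) := by
    refine ENNReal.tendsto_ofReal ?_
    have h1 := tendsto_rpow_neg_atTop hgap0
    have h2 := tendsto_rpow_neg_atTop (show 0 < 1 / (n : ℝ) by positivity)
    exact ((((h1.const_sub 1).const_mul _).sub ((h2.const_sub 1).const_mul _)).const_mul _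
      |>.const_add _).const_mul _
  simp only [sub_zero, mul_one] at hlim
  exact le_of_tendsto hlim ((Filter.eventually_ge_atTop 1).mono hprof)

lemma ofReal_bound_le_lpOptRatio (hp : 1 ≤ p) (hq : 0 < q) (hq1 : q < 1) (hn : 2 ≤ n) :
    ENNReal.ofReal
          ((1 - 1 / (n : ℝ)) *
            (((n : ℝ) + q) / ((n : ℝ) + q - (n : ℝ) * q) *
                (((n : ℝ) / q + 1) / unitBallVolume p n) ^ (1 / ((n : ℝ) / q + 1)) +
              1 / ((n : ℝ) - 1) -
              min ((2 : ℝ) ^ (-q) * (n : ℝ) ^ (q * (p⁻¹).toReal + 1) / ((n : ℝ) + q))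
                (max ((((n : ℝ) / q + 1) / unitBallVolume p n) ^ (1 / ((n : ℝ) / q + 1)) - 1)
                    0 +
                  q * (n : ℝ) ^ ((p⁻¹).toReal + 1) / (2 * ((n : ℝ) + 1)))))
        ≤ lpOptRatio n p q := by
  have hn1 : (1 : ℝ) < n := by exact_mod_cast (by omega : 1 < n)
  have hs : 1 / (n : ℝ) ≤ 1 := by rw [div_le_one (by linarith)]; exact hn1.le
  have hsplit : ∀ x y : ℝ, (1 - 1 / (n : ℝ)) * (x + 1 / ((n : ℝ) - 1) - y) =
      1 / n + (1 - 1 / (n : ℝ)) * (x - y) := by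
    intro x y
    have : (n : ℝ) - 1 ≠ 0 := by linarith
    field_simp
    ring
  rw [hsplit]
  set Y := ((n : ℝ) + q) / (n + q - n * q) *
    ((n / q + 1) / unitBallVolume p n) ^ (1 / ((n : ℝ) / q + 1)) with hY
  set m := max ((((n : ℝ) / q + 1) / unitBallVolume p n) ^ (1 / ((n : ℝ) / q + 1)) - 1) 0
  have hm : 0 ≤ m := le_max_right _ _
  have hdouble : ∀ A : ℝ, ENNReal.ofReal (2 * A) ≤ lpOptRatio n p q →
      ENNReal.ofReal A ≤ lpOptRatio n p q := by
    intro A hA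
    rcases le_total A 0 with h | h
    · simp [ENNReal.ofReal_of_nonpos h]
    · exact (ENNReal.ofReal_le_ofReal (by linarith)).trans hA
  rcases min_choice ((2 : ℝ) ^ (-q) * (n : ℝ) ^ (q * (p⁻¹).toReal + 1) / ((n : ℝ) + q))
    (m + q * (n : ℝ) ^ ((p⁻¹).toReal + 1) / (2 * ((n : ℝ) + 1))) with h | h
  · rw [h]
    exact hdouble _ (ofReal_profile_le_lpOptRatio hp hq hq1 hn (by positivity)
      (isCellCorrection_subadditive hp hq hq1 (by omega)))
  · rw [h]
    have hA := ofReal_profile_le_lpOptRatio hp hq hq1 hn (by positivity)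
      (isCellCorrection_concave hp hq hq1 (by omega))
    rw [← hY] at hA
    set β := q * (n : ℝ) ^ ((p⁻¹).toReal + 1) / (2 * ((n : ℝ) + 1))
    have hle : 1 / (n : ℝ) + (1 - 1 / (n : ℝ)) * (Y - (m + β)) ≤
        1 / n + (1 - 1 / (n : ℝ)) * (Y - β) := by
      have : 0 ≤ 1 - 1 / (n : ℝ) := by linarith
      gcongr
      linarith
    refine (ENNReal.ofReal_le_ofReal hle).trans ?_
    rcases le_total (1 / n + (1 - 1 / (n : ℝ)) * (Y - β)) 2 with h2 | h2
    · refine le_trans ?_ (two_le_lpOptRatio hp hq hq1 hn)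
      exact ENNReal.ofReal_le_of_le_toReal (by simpa using h2)
    · refine le_trans (ENNReal.ofReal_le_ofReal ?_) hA
      have h0 : 0 < 1 / (n : ℝ) := by positivity
      nlinarith

end

lemma exp_neg_mul_rpow_le_Gamma_one_add {y : ℝ} (hy : 0 < y) :
    Real.exp (-y) * y ^ y ≤ Real.Gamma (1 + y) := by
  have hG := Real.GammaIntegral_convergent (show 0 < 1 + y by linarith)
  have hpos : ∀ t ∈ Set.Ioi (0 : ℝ), 0 ≤ Real.exp (-t) * t ^ (1 + y - 1) := fun t ht =>
    mul_nonneg (Real.exp_pos _).le (Real.rpow_nonneg (le_of_lt ht) _)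
  rw [Real.Gamma_eq_integral (by linarith), ← integral_exp_neg_Ioi, ← integral_mul_const]
  refine le_trans ?_ (setIntegral_mono_set hG ((ae_restrict_iff' measurableSet_Ioi).2
    (Filter.Eventually.of_forall hpos)) (Set.Ioi_subset_Ioi hy.le).eventuallyLE)
  refine setIntegral_mono_on ((integrableOn_exp_neg_Ioi y).mul_const _)
    (hG.mono_set (Set.Ioi_subset_Ioi hy.le)) measurableSet_Ioi fun t ht => ?_
  have ht' : y < t := ht
  rw [add_sub_cancel_left]
  gcongr

lemma Gamma_one_add_le_one {x : ℝ} (hx0 : 0 ≤ x) (hx1 : x ≤ 1) : Real.Gamma (1 + x) ≤ 1 := by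
  have := Real.convexOn_Gamma.2 (x := 1) (y := 2) (by simp) (by simp)
    (show 0 ≤ 1 - x by linarith) hx0 (by ring)
  simp only [smul_eq_mul, Real.Gamma_one, Real.Gamma_two] at this
  rw [show (1 - x) * 1 + x * 2 = 1 + x by ring] at this
  linarith

lemma exp_neg_one_le_exp_neg_mul_rpow {x : ℝ} (hx : 0 < x) :
    Real.exp (-1) ≤ Real.exp (-x) * x ^ x := by
  rw [Real.rpow_def_of_pos hx, ← Real.exp_add]
  refine Real.exp_le_exp.2 ?_
  have h := mul_le_mul_of_nonneg_left (Real.one_sub_inv_le_log_of_pos hx) hx.le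
  rw [mul_sub, mul_inv_cancel₀ hx.ne'] at h
  linarith

section

variable {p : ℝ≥0∞} {q : ℝ} {n : ℕ}

lemma pow_le_inv_unitBallVolume (hx0 : 0 < (p⁻¹).toReal) (hx1 : (p⁻¹).toReal ≤ 1) (hn : 0 < n) :
    ((n : ℝ) ^ (p⁻¹).toReal / (2 * Real.exp 1)) ^ n ≤ (unitBallVolume p n)⁻¹ := by
  unfold unitBallVolume
  set x := (p⁻¹).toReal
  have hn0 : (0 : ℝ) < n := by exact_mod_cast hn
  have hG0 : 0 < Real.Gamma (1 + x) := Real.Gamma_pos_of_pos (by linarith)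
  have h1 : Real.exp (-1) ^ n * ((n : ℝ) ^ x) ^ n ≤ Real.Gamma (1 + n * x) := by
    refine le_trans ?_ (exp_neg_mul_rpow_le_Gamma_one_add (by positivity))
    calc _ ≤ (Real.exp (-x) * x ^ x) ^ n * ((n : ℝ) ^ x) ^ n := by
          gcongr
          exact exp_neg_one_le_exp_neg_mul_rpow hx0
      _ = _ := by
          rw [Real.mul_rpow hn0.le hx0.le, mul_pow, ← Real.exp_nat_mul, mul_comm (n : ℝ) x,
            Real.rpow_mul hn0.le, Real.rpow_natCast, Real.rpow_mul hx0.le, Real.rpow_natCast]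
          ring_nf
  have h2 : Real.Gamma (1 + x) ^ n ≤ 1 := pow_le_one₀ hG0.le (Gamma_one_add_le_one hx0.le hx1)
  rw [inv_div, le_div_iff₀ (by positivity), div_pow, mul_pow]
  calc _ = (Real.exp (-1) ^ n * ((n : ℝ) ^ x) ^ n) * Real.Gamma (1 + x) ^ n := by
        rw [Real.exp_neg, inv_pow]
        field_simp
    _ ≤ Real.Gamma (1 + n * x) * 1 := by gcongr
    _ = _ := mul_one _

lemma le_rpow_div_unitBallVolume (hx0 : 0 < (p⁻¹).toReal) (hx1 : (p⁻¹).toReal ≤ 1) (hq : 0 < q)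
    (hq1 : q < 1) (hn : 0 < n) :
    (n : ℝ) ^ (q * (p⁻¹).toReal) * (2 * Real.exp 1) ^ (-q) * (n : ℝ) ^ (-1 / (n : ℝ)) ≤
      (((n : ℝ) / q + 1) / unitBallVolume p n) ^ (1 / ((n : ℝ) / q + 1)) := by
  have hn0 : (0 : ℝ) < n := by exact_mod_cast hn
  have hn1 : (1 : ℝ) ≤ n := by exact_mod_cast hn
  have hV := unitBallVolume_pos p n
  have hpow := pow_le_inv_unitBallVolume hx0 hx1 hn
  set x := (p⁻¹).toReal
  have he : 1 ≤ 2 * Real.exp 1 := by linarith [Real.add_one_le_exp 1]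
  have hN : 1 ≤ (n : ℝ) / q + 1 := by
    have : 0 < (n : ℝ) / q := by positivity
    linarith
  have hexp : (n : ℝ) * (1 / (n / q + 1)) = q * n / (n + q) := by field_simp
  calc _ = (n : ℝ) ^ (q * x - 1 / n) * (2 * Real.exp 1) ^ (-q) := by
        rw [sub_eq_add_neg, Real.rpow_add hn0, neg_div]
        ring
    _ ≤ (n : ℝ) ^ (x * (q * n / (n + q))) * (2 * Real.exp 1) ^ (-(q * n / (n + q))) := by
        gcongr
        · rw [show x * (q * n / (n + q)) = q * x - x * q ^ 2 / (n + q) by field_simp; ring]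
          have : x * q ^ 2 / (n + q) ≤ 1 / n := by
            have : x * q ^ 2 ≤ 1 := mul_le_one₀ hx1 (by positivity) (pow_le_one₀ hq.le hq1.le)
            gcongr
            linarith
          linarith
        · rw [div_le_iff₀ (by positivity)]
          nlinarith
    _ = (((n : ℝ) ^ x / (2 * Real.exp 1)) ^ n) ^ (1 / ((n : ℝ) / q + 1)) := by
        rw [← Real.rpow_natCast, ← Real.rpow_mul (by positivity), hexp,
          Real.div_rpow (by positivity) (by positivity), ← Real.rpow_mul hn0.le,
          Real.rpow_neg (by positivity), ← div_eq_mul_inv]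
    _ ≤ _ := by
        gcongr
        refine hpow.trans ?_
        rw [div_eq_mul_inv]
        exact le_mul_of_one_le_left (by positivity) hN

lemma exists_mul_rpow_le_lpOptRatio (hp : 1 ≤ p) (hq : 0 < q) (hq1 : q < 1) :
    ∃ C : ℝ, 0 < C ∧ ∃ N : ℕ, ∀ n : ℕ, N ≤ n →
        ENNReal.ofReal (C * (n : ℝ) ^ (q * (p⁻¹).toReal)) ≤ lpOptRatio n p q := by
  rcases eq_or_lt_of_le (toReal_nonneg : 0 ≤ (p⁻¹).toReal) with hx | hx0
  · refine ⟨1, one_pos, 2, fun n hn => le_trans ?_ (two_le_lpOptRatio hp hq hq1 hn)⟩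
    rw [← hx]
    simp
  have hx1 : (p⁻¹).toReal ≤ 1 := by
    refine ENNReal.toReal_le_of_le_ofReal zero_le_one ?_
    simpa using hp
  set L := 1 / (1 - q) * Real.exp (-q) with hL
  have hL1 : 1 < L := by
    rw [hL, one_div_mul_eq_div, lt_div_iff₀ (by linarith)]
    linarith [Real.add_one_lt_exp (neg_ne_zero.2 hq.ne')]
  have hlim : Filter.Tendsto (fun n : ℕ => ((n : ℝ) + q) / (n + q - n * q) * Real.exp (-q) *
      (n : ℝ) ^ (-1 / (n : ℝ))) Filter.atTop (nhds L) := by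
    have h1 : Filter.Tendsto (fun n : ℕ => (n : ℝ) ^ (-1 / (n : ℝ))) Filter.atTop (nhds 1) :=
      tendsto_rpow_neg_div.comp tendsto_natCast_atTop_atTop
    have h2 : Filter.Tendsto (fun n : ℕ => ((n : ℝ) + q) / (n + q - n * q)) Filter.atTop
        (nhds (1 / (1 - q))) := by
      have h3 : Filter.Tendsto (fun n : ℕ => q / (n : ℝ)) Filter.atTop (nhds 0) :=
        tendsto_const_div_atTop_nhds_zero_nat q
      have h4 : Filter.Tendsto (fun n : ℕ => (1 + q / (n : ℝ)) / (1 - q + q / n)) Filter.atTop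
          (nhds ((1 + 0) / (1 - q + 0))) :=
        (h3.const_add 1).div (h3.const_add (1 - q)) (by linarith)
      rw [add_zero, add_zero] at h4
      refine h4.congr' ((Filter.eventually_gt_atTop 0).mono fun n hn => ?_)
      have hn0 : (0 : ℝ) < n := by exact_mod_cast hn
      dsimp only
      rw [show (n : ℝ) + q - n * q = n * (1 - q + q / n) by field_simp; ring,
        show (n : ℝ) + q = n * (1 + q / n) by field_simp, mul_div_mul_left _ _ hn0.ne']
    simpa [hL] using (h2.mul_const (Real.exp (-q))).mul h1
  obtain ⟨N, hN⟩ := Filter.eventually_atTop.1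
    (hlim.eventually (lt_mem_nhds (show (1 + L) / 2 < L by linarith)))
  refine ⟨2 ^ (-q) * ((L - 1) / 2), mul_pos (by positivity) (by linarith), max N 2,
    fun n hn => ?_⟩
  have hn2 : 2 ≤ n := le_of_max_le_right hn
  have hn2' : (2 : ℝ) ≤ n := by exact_mod_cast hn2
  have hn0 : (0 : ℝ) < n := by linarith
  have hnN := hN n (le_of_max_le_left hn)
  have hnq : 0 < (n : ℝ) + q - n * q := by nlinarith
  have hB := le_rpow_div_unitBallVolume hx0 hx1 hq hq1 (n := n) (by omega)
  refine le_trans (ENNReal.ofReal_le_ofReal ?_)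
    (ofReal_profile_le_lpOptRatio hp hq hq1 hn2 (by positivity)
      (isCellCorrection_subadditive hp hq hq1 (by omega)))
  set x := (p⁻¹).toReal
  set B := (((n : ℝ) / q + 1) / unitBallVolume p n) ^ (1 / ((n : ℝ) / q + 1))
  set θ := ((n : ℝ) + q) / (n + q - n * q)
  have hθ : 0 ≤ θ := by positivity
  have hA : 0 < (n : ℝ) ^ (q * x) := by positivity
  have h2q : (0 : ℝ) < 2 ^ (-q) := by positivity
  have hcorr : (2 : ℝ) ^ (-q) * (n : ℝ) ^ (q * x + 1) / (n + q) ≤ 2 ^ (-q) * (n : ℝ) ^ (q * x) := by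
    rw [div_le_iff₀ (by positivity), Real.rpow_add hn0, Real.rpow_one, ← mul_assoc]
    gcongr
    linarith
  have hθB : 2 ^ (-q) * (n : ℝ) ^ (q * x) * ((1 + L) / 2) ≤ θ * B := by
    calc _ ≤ 2 ^ (-q) * (n : ℝ) ^ (q * x) * (θ * Real.exp (-q) * (n : ℝ) ^ (-1 / (n : ℝ))) := by
          gcongr
      _ = θ * ((n : ℝ) ^ (q * x) * (2 * Real.exp 1) ^ (-q) * (n : ℝ) ^ (-1 / (n : ℝ))) := by
          rw [Real.mul_rpow (by norm_num) (Real.exp_pos 1).le, ← Real.exp_mul, one_mul]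
          ring
      _ ≤ θ * B := by gcongr
  have hs : 1 / (n : ℝ) ≤ 1 / 2 := by gcongr
  have hs0 : 0 < 1 / (n : ℝ) := by positivity
  have hdiff : 2 ^ (-q) * ((L - 1) / 2) * (n : ℝ) ^ (q * x) ≤
      θ * B - 2 ^ (-q) * (n : ℝ) ^ (q * x + 1) / (n + q) := by
    linarith
  have hpos : 0 < 2 ^ (-q) * ((L - 1) / 2) * (n : ℝ) ^ (q * x) :=
    mul_pos (mul_pos h2q (by linarith)) hA
  nlinarith

end

/-- dimension-dependent lower bound for `ℓ_p` snowflake costs. For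
`p ∈ [1,∞]` and `0 < q < 1` and every `n ≥ 2`, with `V = V_{n,p}` and
`B = ((n/q + 1)/V)^{1/(n/q + 1)}`,
`r*_{‖·‖_p^q}(P(ℝⁿ)) ≥ (1 − 1/n) ((n+q)/(n+q−nq) · B + 1/(n−1)
  − min {2^{−q} n^{q/p+1}/(n+q), max {B − 1, 0} + q n^{1/p+1}/(2(n+1))})`;
in particular `r*(P(ℝⁿ)) = Ω(n^{q/p})` as `n → ∞`. -/
theorem lp_snowflake_optRatio_lower_bound (p : ℝ≥0∞) (hp : 1 ≤ p)
    (q : ℝ) (hq0 : 0 < q) (hq1 : q < 1) :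
    (∀ n : ℕ, 2 ≤ n →
      ENNReal.ofReal
          ((1 - 1 / (n : ℝ)) *
            (((n : ℝ) + q) / ((n : ℝ) + q - (n : ℝ) * q) *
                (((n : ℝ) / q + 1) / unitBallVolume p n) ^ (1 / ((n : ℝ) / q + 1)) +
              1 / ((n : ℝ) - 1) -
              min ((2 : ℝ) ^ (-q) * (n : ℝ) ^ (q * (p⁻¹).toReal + 1) / ((n : ℝ) + q))
                (max ((((n : ℝ) / q + 1) / unitBallVolume p n) ^ (1 / ((n : ℝ) / q + 1)) - 1)
                    0 +
                  q * (n : ℝ) ^ ((p⁻¹).toReal + 1) / (2 * ((n : ℝ) + 1)))))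
        ≤ lpOptRatio n p q) ∧
      ∃ C : ℝ, 0 < C ∧ ∃ N : ℕ, ∀ n : ℕ, N ≤ n →
        ENNReal.ofReal (C * (n : ℝ) ^ (q * (p⁻¹).toReal)) ≤ lpOptRatio n p q := by
  exact ⟨fun n hn => ofReal_bound_le_lpOptRatio hp hq0 hq1 hn,
    exists_mul_rpow_le_lpOptRatio hp hq0 hq1⟩

end
end

section
/- Let p ∈ [1,∞) be real and q > 0. Let X = ℓ_p be the space of real sequences x = (x_1, x_2, …) with Σ_{i=1}^∞ |x_i|^p < ∞, equipped with the norm ‖x‖_p = (Σ_{i=1}^∞ |x_i|^p)^{1/p}, and let c(x,y) := ‖x − y‖_p^q. Then r*_c(P(ℓ_p)) = ∞. -/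
open MeasureTheory ENNReal

noncomputable section

/-- The sign character of `ZMod 2`. -/
def signChar (a : ZMod 2) : ℝ := if a = 0 then 1 else -1

lemma signChar_add (a b : ZMod 2) : signChar (a + b) = signChar a * signChar b := by
  have h : ∀ a : ZMod 2, a = 0 ∨ a = 1 := by decide
  have h2 : (1 + 1 : ZMod 2) = 0 := by decide
  rcases h a with rfl | rfl <;> rcases h b with rfl | rfl <;> simp [signChar, h2]

lemma signChar_mul_self (a : ZMod 2) : signChar a * signChar a = 1 := by
  unfold signChar; split_ifs <;> simp

/-- The character of `(ZMod 2)^ι` attached to the vector `b`. -/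
def cubeChar {ι : Type*} [Fintype ι] (b a : ι → ZMod 2) : ℝ := signChar (∑ i, b i * a i)

section Characters

variable {ι : Type*} [Fintype ι]

lemma cubeChar_add (b a a' : ι → ZMod 2) :
    cubeChar b (a + a') = cubeChar b a * cubeChar b a' := by
  simp [cubeChar, mul_add, Finset.sum_add_distrib, signChar_add]

lemma cubeChar_comm (a b : ι → ZMod 2) : cubeChar a b = cubeChar b a := by
  simp [cubeChar, mul_comm]

lemma cubeChar_zero_left (a : ι → ZMod 2) : cubeChar 0 a = 1 := by
  simp [cubeChar, signChar]

lemma cubeChar_zero_right (a : ι → ZMod 2) : cubeChar a 0 = 1 := by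
  simp [cubeChar, signChar]

lemma sum_cubeChar [DecidableEq ι] (a : ι → ZMod 2) :
    ∑ b, cubeChar b a = if a = 0 then (Fintype.card (ι → ZMod 2) : ℝ) else 0 := by
  split_ifs with h
  · simp [h, cubeChar_zero_right]
  · obtain ⟨j, hj⟩ := Function.ne_iff.1 h
    have h1 : ∀ x : ZMod 2, x ≠ 0 → x = 1 := by decide
    have key : ∑ b, cubeChar b a = ∑ b, -cubeChar b a := by
      refine Fintype.sum_equiv (Equiv.addRight (Pi.single j 1)) _ _ fun b => ?_
      have hs : cubeChar (Pi.single j 1) a = -1 := by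
        simp [cubeChar, Pi.single_apply, signChar, h1 _ hj]
      rw [Equiv.coe_addRight, cubeChar_comm (b + _), cubeChar_add, cubeChar_comm a (Pi.single j 1),
        hs, cubeChar_comm a b]
      ring
    rw [Finset.sum_neg_distrib] at key
    linarith

/-- Wiener–Khinchin: the Fourier expansion of the autocorrelation of `f`. -/
lemma sum_sq_mul_cubeChar [DecidableEq ι] (f : (ι → ZMod 2) → ℝ) (g : ι → ZMod 2) :
    ∑ b, (∑ a, f a * cubeChar b a) ^ 2 * cubeChar b g =
      Fintype.card (ι → ZMod 2) * ∑ a, f a * f (a + g) := by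
  have hz : ∀ a a' : ι → ZMod 2, a' + a + g = 0 ↔ a' = a + g := by
    intro a a'
    have h2 : a + g + (a + g) = 0 := funext fun j => CharTwo.add_self_eq_zero ((a + g) j)
    rw [add_assoc]
    constructor
    · intro h
      exact add_right_cancel (h.trans h2.symm)
    · rintro rfl
      exact h2
  calc ∑ b, (∑ a, f a * cubeChar b a) ^ 2 * cubeChar b g
      = ∑ b, ∑ a, ∑ a', f a * f a' * cubeChar b (a' + a + g) := by
        refine Finset.sum_congr rfl fun b _ => ?_
        rw [sq, Finset.sum_mul_sum, Finset.sum_mul]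
        refine Finset.sum_congr rfl fun a _ => ?_
        rw [Finset.sum_mul]
        refine Finset.sum_congr rfl fun a' _ => ?_
        rw [cubeChar_add, cubeChar_add]
        ring
    _ = ∑ a, ∑ a', f a * f a' * ∑ b, cubeChar b (a' + a + g) := by
        rw [Finset.sum_comm]
        refine Finset.sum_congr rfl fun a _ => ?_
        rw [Finset.sum_comm]
        simp_rw [Finset.mul_sum]
    _ = _ := by
        rw [Finset.mul_sum]
        refine Finset.sum_congr rfl fun a _ => ?_
        simp only [sum_cubeChar, hz, mul_ite, mul_zero, Finset.sum_ite_eq',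
          Finset.mem_univ, if_true]
        ring

/-- A Poincaré inequality on `(ZMod 2)^ι`: a family of shifts against which every nontrivial
character averages to at most `1/2` has a spectral gap. -/
lemma two_mul_sum_shift_le [DecidableEq ι] {I : Type*} [Fintype I] (g : I → ι → ZMod 2)
    (hg : ∀ b, b ≠ 0 → 2 * ∑ i, cubeChar b (g i) ≤ Fintype.card I) (f : (ι → ZMod 2) → ℝ) :
    2 * Fintype.card (ι → ZMod 2) * ∑ i, ∑ a, f a * f (a + g i) ≤
      Fintype.card I * (∑ a, ∑ a', f a * f a') +
        Fintype.card I * Fintype.card (ι → ZMod 2) * ∑ a, f a * f a := by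
  set F : (ι → ZMod 2) → ℝ := fun b => ∑ a, f a * cubeChar b a with hF
  have hparseval : ∑ b, F b ^ 2 = Fintype.card (ι → ZMod 2) * ∑ a, f a * f a := by
    simpa [cubeChar_zero_right] using sum_sq_mul_cubeChar f 0
  have hF0 : F 0 ^ 2 = ∑ a, ∑ a', f a * f a' := by
    simp [hF, cubeChar_zero_left, sq, Finset.sum_mul_sum]
  calc 2 * Fintype.card (ι → ZMod 2) * ∑ i, ∑ a, f a * f (a + g i)
      = 2 * ∑ i, ∑ b, F b ^ 2 * cubeChar b (g i) := by
        simp_rw [hF, sum_sq_mul_cubeChar, ← Finset.mul_sum]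
        ring
    _ = ∑ b, F b ^ 2 * (2 * ∑ i, cubeChar b (g i)) := by
        rw [Finset.sum_comm, Finset.mul_sum]
        refine Finset.sum_congr rfl fun b _ => ?_
        rw [← Finset.mul_sum]
        ring
    _ ≤ ∑ b, (F b ^ 2 * Fintype.card I + if b = 0 then F b ^ 2 * Fintype.card I else 0) := by
        refine Finset.sum_le_sum fun b _ => ?_
        split_ifs with h
        · subst h
          simp only [cubeChar_zero_left, Finset.sum_const, Finset.card_univ, nsmul_eq_mul]
          linarith
        · rw [add_zero]
          exact mul_le_mul_of_nonneg_left (hg b h) (sq_nonneg _)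
    _ = _ := by
        rw [Finset.sum_add_distrib, ← Finset.sum_mul, hparseval, Finset.sum_ite_eq',
          if_pos (Finset.mem_univ _), hF0]
        ring

end Characters

/-- The rank-one matrix `u ⊗ v` over `ZMod 2`. -/
def rankOne {J : Type*} (i : (J → ZMod 2) × (J → ZMod 2)) : J × J → ZMod 2 :=
  fun k => i.1 k.1 * i.2 k.2

lemma two_mul_sum_cubeChar_rankOne_le {J : Type*} [Fintype J] [DecidableEq J]
    (b : J × J → ZMod 2) (hb : b ≠ 0) :
    2 * ∑ i, cubeChar b (rankOne i) ≤ Fintype.card ((J → ZMod 2) × (J → ZMod 2)) := by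
  obtain ⟨⟨j, k⟩, hjk⟩ := Function.ne_iff.1 hb
  have hrow : (fun l => b (j, l)) ≠ 0 := fun h => hjk (congrFun h k)
  set N : ℝ := (Fintype.card (J → ZMod 2) : ℝ) with hN
  have hχ : ∀ u v : J → ZMod 2,
      cubeChar b (rankOne (u, v)) = cubeChar u (fun i => ∑ l, b (i, l) * v l) := by
    intro u v
    simp only [cubeChar, rankOne, Fintype.sum_prod_type, Finset.mul_sum]
    congr 1
    exact Finset.sum_congr rfl fun i _ => Finset.sum_congr rfl fun l _ => by ring
  have hv : ∀ v : J → ZMod 2, 2 * ∑ u, cubeChar b (rankOne (u, v)) ≤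
      N * (1 + cubeChar v fun l => b (j, l)) := by
    intro v
    simp_rw [hχ, sum_cubeChar]
    have hge : ∀ a : ZMod 2, 0 ≤ 1 + signChar a := by
      intro a; unfold signChar; split_ifs <;> norm_num
    split_ifs with h
    · have h0 : ∑ l, v l * b (j, l) = 0 := by
        simpa [mul_comm] using congrFun h j
      simp only [cubeChar, h0, signChar, if_true]
      linarith
    · rw [mul_zero]
      exact mul_nonneg (by positivity) (hge _)
  calc 2 * ∑ i, cubeChar b (rankOne i) = ∑ v, 2 * ∑ u, cubeChar b (rankOne (u, v)) := by
        rw [Fintype.sum_prod_type_right, Finset.mul_sum]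
    _ ≤ ∑ v : J → ZMod 2, N * (1 + cubeChar v fun l => b (j, l)) :=
        Finset.sum_le_sum fun v _ => hv v
    _ = _ := by
        rw [← Finset.mul_sum, Finset.sum_add_distrib, sum_cubeChar, if_neg hrow]
        simp [hN]

/-- The kernel `ρ ^ hammingDist` is a nonnegative combination of products of signs. -/
lemma sum_weight_mul_signs {I : Type*} [Fintype I] [DecidableEq I] (t : ℝ) (x y : I → ZMod 2) :
    ∑ T : Finset I, (t ^ T.card * (1 - t) ^ (Finset.univ \ T).card) *
        ((∏ i ∈ T, signChar (x i)) * ∏ i ∈ T, signChar (y i)) =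
      (1 - 2 * t) ^ hammingDist x y := by
  have h := Finset.prod_add (fun i => t * (signChar (x i) * signChar (y i)))
    (fun _ : I => 1 - t) Finset.univ
  have hfac : ∀ i, t * (signChar (x i) * signChar (y i)) + (1 - t) =
      if x i ≠ y i then 1 - 2 * t else 1 := by
    intro i
    have hs : ∀ a b : ZMod 2, a ≠ b → signChar a * signChar b = -1 := by
      intro a b hab
      have h : ∀ a : ZMod 2, a = 0 ∨ a = 1 := by decide
      rcases h a with rfl | rfl <;> rcases h b with rfl | rfl <;> simp_all [signChar]
    split_ifs with hxy
    · rw [hs _ _ hxy]; ring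
    · rw [not_not.1 hxy, signChar_mul_self]; ring
  simp_rw [hfac] at h
  rw [Finset.prod_ite, Finset.prod_const, Finset.prod_const_one, mul_one, Finset.powerset_univ] at h
  rw [hammingDist, h]
  refine Finset.sum_congr rfl fun T _ => ?_
  rw [Finset.prod_mul_distrib, Finset.prod_mul_distrib, Finset.prod_const, Finset.prod_const]
  ring

lemma exists_fin_sum_eq {I M : Type*} [AddCommMonoid M] (g : I → M) (i₀ : I)
    (h₀ : g i₀ = 0) (R : ℕ) (S : Finset I) (hS : S.card ≤ R) :
    ∃ φ : Fin R → I, ∑ j, g (φ j) = ∑ i ∈ S, g i := by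
  classical
  induction R generalizing S with
  | zero => exact ⟨Fin.elim0, by simp [Finset.card_eq_zero.1 (Nat.le_zero.1 hS)]⟩
  | succ R ih =>
    rcases S.eq_empty_or_nonempty with rfl | ⟨i, hi⟩
    · exact ⟨fun _ => i₀, by simp [h₀]⟩
    · obtain ⟨φ, hφ⟩ := ih (S.erase i) (by rw [Finset.card_erase_of_mem hi]; omega)
      exact ⟨Fin.cons i φ, by simp [Fin.sum_univ_succ, hφ, Finset.add_sum_erase _ _ hi]⟩

/-- `1 - ρ ^ h ≤ h ^ s / R ^ min s 1` for `ρ = 1 - 1 / R`. -/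
lemma rpow_mul_one_sub_pow_le (R : ℕ) (hR : 0 < R) (s : ℝ) (hs : 0 < s) (h : ℕ) :
    (R : ℝ) ^ min s 1 * (1 - (1 - 1 / (R : ℝ)) ^ h) ≤ (h : ℝ) ^ s := by
  rcases Nat.eq_zero_or_pos h with rfl | hh
  · simp [Real.zero_rpow hs.ne']
  have hR1 : (1 : ℝ) ≤ R := by exact_mod_cast hR
  have hh1 : (1 : ℝ) ≤ h := by exact_mod_cast hh
  have hs' : 0 < min s 1 := lt_min hs one_pos
  have hρ0 : 0 ≤ 1 - 1 / (R : ℝ) := by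
    rw [sub_nonneg, div_le_one (by linarith)]; exact hR1
  have hmono : (h : ℝ) ^ min s 1 ≤ (h : ℝ) ^ s :=
    Real.rpow_le_rpow_of_exponent_le hh1 (min_le_left _ _)
  refine le_trans ?_ hmono
  have hdiv : 1 - (1 - 1 / (R : ℝ)) ^ h ≤ ((h : ℝ) / R) ^ min s 1 := by
    rcases le_total (h : ℝ) R with hle | hle
    · have hb := one_add_mul_le_pow (a := -(1 / (R : ℝ))) (by linarith) h
      have hx : 1 - (1 - 1 / (R : ℝ)) ^ h ≤ (h : ℝ) / R := by
        have : (h : ℝ) / R = h * (1 / R) := by ring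
        rw [this]
        have h3 : (1 + -(1 / (R : ℝ))) = 1 - 1 / R := by ring
        rw [h3] at hb
        linarith
      refine hx.trans ?_
      have := Real.rpow_le_rpow_of_exponent_ge (x := (h : ℝ) / R) (by positivity)
        ((div_le_one (by linarith)).2 hle) (min_le_right s 1)
      simpa using this
    · have h1 : 1 ≤ ((h : ℝ) / R) ^ min s 1 :=
        Real.one_le_rpow ((one_le_div (by linarith)).2 hle) hs'.le
      have := pow_nonneg hρ0 h
      linarith
  calc (R : ℝ) ^ min s 1 * (1 - (1 - 1 / (R : ℝ)) ^ h)
      ≤ (R : ℝ) ^ min s 1 * ((h : ℝ) / R) ^ min s 1 := by gcongr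
    _ = (h : ℝ) ^ min s 1 := by
      rw [← Real.mul_rpow (by positivity) (by positivity)]
      congr 1
      field_simp

lemma one_sub_inv_pow_le_half (R : ℕ) (hR : 0 < R) (h : ℕ) (hh : R ≤ h) :
    (1 - 1 / (R : ℝ)) ^ h ≤ 1 / 2 := by
  have hR1 : (1 : ℝ) ≤ R := by exact_mod_cast hR
  have hρ0 : 0 ≤ 1 - 1 / (R : ℝ) := by
    rw [sub_nonneg, div_le_one (by linarith)]; exact hR1
  have hρ1 : 1 - 1 / (R : ℝ) ≤ 1 := by
    have : 0 ≤ 1 / (R : ℝ) := by positivity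
    linarith
  refine (pow_le_pow_of_le_one hρ0 hρ1 hh).trans ?_
  refine (Real.one_sub_div_pow_le_exp_neg hR1).trans ?_
  rw [Real.exp_neg, ← one_div]
  exact one_div_le_one_div_of_le two_pos (by linarith [Real.add_one_le_exp (1 : ℝ)])

/-- Any section of the quotient map `(ZMod 2)^I → (ZMod 2)^ι` determined by shifts `g` with a
spectral gap stretches the shifts a lot on average, provided that few points are sums of
at most `R` shifts. -/
lemma le_sum_hammingDist_rpow {ι I : Type*} [Fintype ι] [DecidableEq ι] [Fintype I]
    [DecidableEq I]     (g : I → ι → ZMod 2) (i₀ : I) (h₀ : g i₀ = 0)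
    (hg : ∀ b, b ≠ 0 → 2 * ∑ i, cubeChar b (g i) ≤ Fintype.card I)
    (R : ℕ) (hR : 0 < R) (hcard : 2 * Fintype.card I ^ R ≤ Fintype.card (ι → ZMod 2))
    (s : ℝ) (hs : 0 < s) (y : (ι → ZMod 2) → I → ZMod 2)
    (hy : ∀ a, ∑ i, y a i • g i = a) :
    (R : ℝ) ^ min s 1 * (Fintype.card I * Fintype.card (ι → ZMod 2)) / 8 ≤
      ∑ i, ∑ a, (hammingDist (y a) (y (a + g i)) : ℝ) ^ s := by
  set V : ℝ := (Fintype.card (ι → ZMod 2) : ℝ) with hV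
  set n : ℝ := (Fintype.card I : ℝ) with hn
  have hVpos : 0 < V := by rw [hV]; exact_mod_cast Fintype.card_pos
  have hnpos : 0 ≤ n := by rw [hn]; positivity
  set ρ : ℝ := 1 - 1 / (R : ℝ) with hρ
  have hR1 : (1 : ℝ) ≤ R := by exact_mod_cast hR
  have hρ0 : 0 ≤ ρ := by
    rw [hρ, sub_nonneg, div_le_one (by linarith)]; exact hR1
  have hinv : 0 ≤ 1 / (R : ℝ) := by positivity
  have hρ1 : ρ ≤ 1 := by linarith
  set K : (ι → ZMod 2) → (ι → ZMod 2) → ℝ := fun a a' => ρ ^ hammingDist (y a) (y a') with hK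
  -- the Poincaré inequality for the kernel
  have hpoinc : 2 * V * ∑ i, ∑ a, K a (a + g i) ≤ n * (∑ a, ∑ a', K a a') + n * V * V := by
    set t : ℝ := 1 / (2 * R) with ht
    have ht2 : 1 - 2 * t = ρ := by rw [ht, hρ]; field_simp
    have ht0 : 0 ≤ t := by positivity
    have ht1 : 0 ≤ 1 - t := by linarith
    set w : Finset I → ℝ := fun T => t ^ T.card * (1 - t) ^ (Finset.univ \ T).card with hw
    set σ : Finset I → (ι → ZMod 2) → ℝ := fun T a => ∏ i ∈ T, signChar (y a i) with hσ
    have hKσ : ∀ a a', K a a' = ∑ T, w T * (σ T a * σ T a') := by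
      intro a a'
      rw [hK, ← ht2]
      exact (sum_weight_mul_signs t (y a) (y a')).symm
    have hKself : ∑ a, K a a = V := by simp [hK, hV]
    have hsum := Finset.sum_le_sum fun (T : Finset I) (_ : T ∈ Finset.univ) =>
      mul_le_mul_of_nonneg_left (two_mul_sum_shift_le g hg (σ T))
        (show 0 ≤ w T from mul_nonneg (pow_nonneg ht0 _) (pow_nonneg ht1 _))
    have e1 : ∑ T, w T * (2 * V * ∑ i, ∑ a, σ T a * σ T (a + g i)) =
        2 * V * ∑ i, ∑ a, K a (a + g i) := by
      simp_rw [hKσ]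
      rw [Finset.mul_sum]
      simp_rw [Finset.mul_sum]
      rw [Finset.sum_comm]
      refine Finset.sum_congr rfl fun i _ => ?_
      rw [Finset.sum_comm]
      exact Finset.sum_congr rfl fun a _ => Finset.sum_congr rfl fun T _ => by ring
    have e2 : ∑ T, w T * (∑ a, ∑ a', σ T a * σ T a') = ∑ a, ∑ a', K a a' := by
      simp_rw [hKσ, Finset.mul_sum]
      rw [Finset.sum_comm]
      refine Finset.sum_congr rfl fun a _ => ?_
      rw [Finset.sum_comm]
    have e3 : ∑ T, w T * (∑ a, σ T a * σ T a) = V := by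
      rw [← hKself]
      simp_rw [hKσ, Finset.mul_sum]
      rw [Finset.sum_comm]
    rw [e1] at hsum
    refine hsum.trans (le_of_eq ?_)
    have e4 : n * V * V = n * V * ∑ T, w T * (∑ a, σ T a * σ T a) := by rw [e3]
    rw [e4, ← e2, Finset.mul_sum, Finset.mul_sum, ← Finset.sum_add_distrib]
    exact Finset.sum_congr rfl fun T _ => by ring
  -- most pairs are far apart
  set B : Finset (ι → ZMod 2) := Finset.univ.image fun φ : Fin R → I => ∑ j, g (φ j) with hB
  have hBcard : 2 * (B.card : ℝ) ≤ V := by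
    have h1 : B.card ≤ Fintype.card I ^ R := by
      refine Finset.card_image_le.trans ?_
      simp
    have h2 : 2 * B.card ≤ Fintype.card (ι → ZMod 2) := by omega
    rw [hV]; exact_mod_cast h2
  have hKle : ∀ a a', K a a' ≤ 1 / 2 + if a - a' ∈ B then 1 / 2 else 0 := by
    intro a a'
    rcases le_or_gt R (hammingDist (y a) (y a')) with hd | hd
    · have h1 := one_sub_inv_pow_le_half R hR _ hd
      refine h1.trans ?_
      split_ifs <;> norm_num
    · have hmem : a - a' ∈ B := by
        obtain ⟨φ, hφ⟩ := exists_fin_sum_eq g i₀ h₀ R {i | y a i ≠ y a' i} hd.le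
        refine Finset.mem_image.2 ⟨φ, Finset.mem_univ _, ?_⟩
        rw [hφ]
        conv_rhs => rw [← hy a, ← hy a', ← Finset.sum_sub_distrib]
        rw [Finset.sum_filter]
        refine Finset.sum_congr rfl fun i _ => ?_
        have h1 : ∀ x x' : ZMod 2, x ≠ x' → x - x' = 1 := by decide
        rw [← sub_smul]
        split_ifs with hi
        · rw [h1 _ _ hi, one_smul]
        · rw [not_not.1 hi, sub_self, zero_smul]
      rw [if_pos hmem]
      have : K a a' ≤ 1 := pow_le_one₀ hρ0 hρ1
      linarith
  have hKsum : ∑ a, ∑ a', K a a' ≤ V * V * (3 / 4) := by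
    have hrow : ∀ a, ∑ a', K a a' ≤ V * (3 / 4) := by
      intro a
      calc ∑ a', K a a' ≤ ∑ a', (1 / 2 + if a - a' ∈ B then (1 / 2 : ℝ) else 0) :=
            Finset.sum_le_sum fun a' _ => hKle a a'
        _ = ∑ a', (1 / 2 + if a' ∈ B then (1 / 2 : ℝ) else 0) :=
            Fintype.sum_equiv (Equiv.subLeft a) _ _ fun a' => by simp
        _ = V * (1 / 2) + B.card * (1 / 2) := by
            rw [Finset.sum_add_distrib, ← Finset.sum_filter]
            simp [hV]
        _ ≤ V * (3 / 4) := by linarith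
    calc ∑ a, ∑ a', K a a' ≤ ∑ _a : ι → ZMod 2, V * (3 / 4) := Finset.sum_le_sum fun a _ => hrow a
      _ = V * V * (3 / 4) := by
        rw [Finset.sum_const, Finset.card_univ, nsmul_eq_mul]
        ring
  have hgap : n * V / 8 ≤ ∑ i, ∑ a, (1 - K a (a + g i)) := by
    have h1 : ∑ i, ∑ a, (1 - K a (a + g i)) = n * V - ∑ i, ∑ a, K a (a + g i) := by
      simp [Finset.sum_sub_distrib, hn, hV]
    rw [h1]
    have h2 : n * (∑ a, ∑ a', K a a') ≤ n * (V * V * (3 / 4)) :=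
      mul_le_mul_of_nonneg_left hKsum hnpos
    have h3 : V * (2 * ∑ i, ∑ a, K a (a + g i)) ≤ V * (n * V * (7 / 4)) := by linarith
    have h4 := le_of_mul_le_mul_left h3 hVpos
    linarith
  calc (R : ℝ) ^ min s 1 * (n * V) / 8 = (R : ℝ) ^ min s 1 * (n * V / 8) := by ring
    _ ≤ (R : ℝ) ^ min s 1 * ∑ i, ∑ a, (1 - K a (a + g i)) := by gcongr
    _ ≤ _ := by
      simp_rw [Finset.mul_sum]
      exact Finset.sum_le_sum fun i _ => Finset.sum_le_sum fun a _ =>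
        rpow_mul_one_sub_pow_le R hR s hs _

/-- The uniform law on the points `e (x + k)`, where `k` runs through the subgroup `K`. -/
def cosetLaw {Y X : Type*} [AddCommGroup Y] (K : AddSubgroup Y) [Fintype K] [MeasurableSpace X]
    (e : Y → X) (x : Y) : Measure X :=
  ∑ k : K, (Fintype.card K : ℝ≥0∞)⁻¹ • Measure.dirac (e (x + k))

section CosetLaw

variable {Y X : Type*} [AddCommGroup Y] (K : AddSubgroup Y) [Fintype K] [MeasurableSpace X]
  (e : Y → X)

lemma sum_card_inv_mul_one : ∑ _k : K, (Fintype.card K : ℝ≥0∞)⁻¹ * 1 = 1 := by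
  simp [ENNReal.mul_inv_cancel]

instance isProbabilityMeasure_cosetLaw (x : Y) : IsProbabilityMeasure (cosetLaw K e x) := by
  constructor
  simp [cosetLaw, ENNReal.mul_inv_cancel]

lemma cosetLaw_add_mem (x : Y) {k : Y} (hk : k ∈ K) :
    cosetLaw K e (x + k) = cosetLaw K e x := by
  refine Fintype.sum_equiv (Equiv.addLeft ⟨k, hk⟩) _ _ fun l => ?_
  simp [add_assoc]

lemma cosetLaw_ae [MeasurableSingletonClass X] (x : Y) :
    ∀ᵐ z ∂cosetLaw K e x, z ∈ Set.range fun k : K => e (x + k) := by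
  rw [ae_iff]
  have hfin : (Set.range fun k : K => e (x + k)).Finite := Set.finite_range _
  have hm : MeasurableSet {z | ¬ z ∈ Set.range fun k : K => e (x + k)} :=
    hfin.measurableSet.compl
  simp only [cosetLaw, Measure.coe_finsetSum, Finset.sum_apply, Measure.smul_apply,
    Measure.dirac_apply' _ hm, smul_eq_mul]
  refine Finset.sum_eq_zero fun k _ => ?_
  have hk : e (x + k) ∉ {z | ¬ z ∈ Set.range fun k : K => e (x + k)} := fun h => h ⟨k, rfl⟩
  rw [Set.indicator_of_notMem hk, mul_zero]

lemma map_finset_sum_smul_dirac {Z W ι : Type*} [MeasurableSpace Z] [MeasurableSpace W]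
    (s : Finset ι) (w : ℝ≥0∞) (z : ι → Z) {φ : Z → W} (hφ : Measurable φ) :
    (∑ i ∈ s, w • Measure.dirac (z i)).map φ = ∑ i ∈ s, w • Measure.dirac (φ (z i)) := by
  rw [← Measure.mapₗ_apply_of_measurable hφ, map_sum]
  refine Finset.sum_congr rfl fun i _ => ?_
  rw [map_smul, Measure.mapₗ_apply_of_measurable hφ, Measure.map_dirac' hφ]

lemma Cstar_cosetLaw_le [MeasurableSingletonClass X] (c : X → X → ℝ) (x x' : Y)
    (hc : ∀ k : K, c (e (x + k)) (e (x' + k)) ≤ 1) :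
    Cstar c (cosetLaw K e x) (cosetLaw K e x') ≤ 1 := by
  set γ : Measure (X × X) :=
    ∑ k : K, (Fintype.card K : ℝ≥0∞)⁻¹ • Measure.dirac (e (x + k), e (x' + k)) with hγ
  have hprob : IsProbabilityMeasure γ := by
    constructor
    simp [hγ, ENNReal.mul_inv_cancel]
  have hfst : γ.map Prod.fst = cosetLaw K e x := map_finset_sum_smul_dirac _ _ _ measurable_fst
  have hsnd : γ.map Prod.snd = cosetLaw K e x' := map_finset_sum_smul_dirac _ _ _ measurable_snd
  refine (iInf₂_le γ ⟨hprob, hfst, hsnd⟩).trans ?_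
  rw [hγ, lintegral_finsetSum_measure]
  simp_rw [lintegral_smul_measure, lintegral_dirac, smul_eq_mul]
  calc _ ≤ ∑ _k : K, (Fintype.card K : ℝ≥0∞)⁻¹ * 1 :=
        Finset.sum_le_sum fun k _ => by
          gcongr
          exact ENNReal.ofReal_le_one.2 (hc k)
    _ = 1 := sum_card_inv_mul_one K

end CosetLaw

/-- The Hamming cube embeds into `ℓ_p` with `‖e x - e y‖ ^ p` equal to the Hamming distance. -/
lemma exists_lp_hamming_embedding {I : Type*} [Fintype I] [DecidableEq I] (p q : ℝ) (hp : 1 ≤ p) :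
    ∃ e : (I → ZMod 2) → lp (fun _ : ℕ => ℝ) (ENNReal.ofReal p),
      ∀ x y, ‖e x - e y‖ ^ q = (hammingDist x y : ℝ) ^ (q / p) := by
  have hp0 : 0 < p := by linarith
  have hpr : (ENNReal.ofReal p).toReal = p := ENNReal.toReal_ofReal hp0.le
  have : Encodable I := Fintype.toEncodable I
  set enc : I ↪ ℕ := Encodable.encode' I
  set b : ZMod 2 → ℝ := fun a => if a = 0 then 0 else 1 with hb
  set f : (I → ZMod 2) → ℕ → ℝ := fun x => Function.extend enc (fun i => b (x i)) 0 with hf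
  refine ⟨fun x => ∑ j ∈ Finset.univ.map enc, lp.single (ENNReal.ofReal p) j (f x j),
    fun x y => ?_⟩
  have hdiff : (∑ j ∈ Finset.univ.map enc, lp.single (ENNReal.ofReal p) j (f x j)) -
      ∑ j ∈ Finset.univ.map enc, lp.single (ENNReal.ofReal p) j (f y j) =
      ∑ j ∈ Finset.univ.map enc,
        lp.single (E := fun _ : ℕ => ℝ) (ENNReal.ofReal p) j (f x j - f y j) := by
    rw [← Finset.sum_sub_distrib]
    exact Finset.sum_congr rfl fun j _ => (lp.single_sub _ _ _ _).symm
  have hnorm := lp.norm_sum_single (E := fun _ : ℕ => ℝ) (p := ENNReal.ofReal p)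
    (by rw [hpr]; exact hp0) (fun j => f x j - f y j) (Finset.univ.map enc)
  rw [← hdiff, hpr] at hnorm
  have hterm : ∀ i, ‖f x (enc i) - f y (enc i)‖ ^ p = if x i ≠ y i then (1 : ℝ) else 0 := by
    intro i
    rw [hf]
    beta_reduce
    rw [enc.injective.extend_apply, enc.injective.extend_apply]
    have h : ∀ a : ZMod 2, a = 0 ∨ a = 1 := by decide
    rcases h (x i) with hx | hx <;> rcases h (y i) with hy | hy <;>
      simp [hb, hx, hy, Real.zero_rpow hp0.ne']
  replace hnorm := hnorm.trans
    ((Finset.sum_map _ _ _).trans (Finset.sum_congr rfl fun i _ => hterm i))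
  rw [Finset.sum_boole] at hnorm
  beta_reduce
  rw [hammingDist, ← hnorm, ← Real.rpow_mul (lp.norm_nonneg' _), mul_div_cancel₀ _ hp0.ne']

/-- Every matrix over `ZMod 2` is a combination of rank-one matrices. -/
lemma exists_sum_smul_rankOne {J : Type*} [Fintype J] [DecidableEq J] (a : J × J → ZMod 2) :
    ∃ x : (J → ZMod 2) × (J → ZMod 2) → ZMod 2, ∑ i, x i • rankOne i = a := by
  have h1 : ∀ k : J × J, rankOne (Pi.single k.1 1, Pi.single k.2 1) = Pi.single k (1 : ZMod 2) := by
    rintro ⟨k, l⟩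
    funext ⟨i, j⟩
    simp only [rankOne, Pi.single_apply, Prod.mk.injEq]
    split_ifs <;> simp_all
  refine ⟨∑ k, a k • Pi.single (Pi.single k.1 1, Pi.single k.2 1) 1, ?_⟩
  rw [← Fintype.linearCombination_apply (ZMod 2), map_sum]
  simp_rw [map_smul, Fintype.linearCombination_apply_single, h1, one_smul]
  funext k
  simp [Pi.single_apply]

/-- A family of shifts with a spectral gap, with fewer `R`-fold sums than half the
points of the group, forces the coupling ratio to be at least `R ^ min (q / p) 1 / 8`. -/
lemma rpow_le_of_isCoupling_of_spectral_gap {ι I : Type*} [Fintype ι] [DecidableEq ι] [Fintype I]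
    [DecidableEq I] (g : I → ι → ZMod 2) (i₀ : I) (h₀ : g i₀ = 0)
    (hg : ∀ b, b ≠ 0 → 2 * ∑ i, cubeChar b (g i) ≤ Fintype.card I)
    (hspan : ∀ a, ∃ x : I → ZMod 2, ∑ i, x i • g i = a) (R : ℕ) (hR : 0 < R)
    (hcard : 2 * Fintype.card I ^ R ≤ Fintype.card (ι → ZMod 2)) (p q : ℝ) (hp : 1 ≤ p) (hq : 0 < q)
    [Fact (1 ≤ ENNReal.ofReal p)]
    [MeasurableSpace (lp (fun _ : ℕ => ℝ) (ENNReal.ofReal p))]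
    [BorelSpace (lp (fun _ : ℕ => ℝ) (ENNReal.ofReal p))]
    (f : ProbabilityMeasure (lp (fun _ : ℕ => ℝ) (ENNReal.ofReal p)) → ℝ →
      lp (fun _ : ℕ => ℝ) (ENNReal.ofReal p))
    (hf : IsCoupling (fun P : ProbabilityMeasure (lp (fun _ : ℕ => ℝ) (ENNReal.ofReal p)) =>
      (P : Measure (lp (fun _ : ℕ => ℝ) (ENNReal.ofReal p)))) f)
    (r : ℝ≥0∞)
    (hr : ∀ a b, ∫⁻ u, ENNReal.ofReal (‖f a u - f b u‖ ^ q) ∂stdSpace ≤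
      r * Cstar (fun x y : lp (fun _ : ℕ => ℝ) (ENNReal.ofReal p) => ‖x - y‖ ^ q)
        (a : Measure (lp (fun _ : ℕ => ℝ) (ENNReal.ofReal p)))
        (b : Measure (lp (fun _ : ℕ => ℝ) (ENNReal.ofReal p)))) :
    ENNReal.ofReal ((R : ℝ) ^ min (q / p) 1 / 8) ≤ r := by
  classical
  have hs : 0 < q / p := div_pos hq (by linarith)
  let π : (I → ZMod 2) →ₗ[ZMod 2] (ι → ZMod 2) := Fintype.linearCombination (ZMod 2) g
  have hπ : ∀ x, π x = ∑ i, x i • g i := fun x => Fintype.linearCombination_apply _ _ _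
  let K : AddSubgroup (I → ZMod 2) := (LinearMap.ker π).toAddSubgroup
  have hK : ∀ x, x ∈ K ↔ π x = 0 := fun x => LinearMap.mem_ker
  obtain ⟨e, he⟩ := exists_lp_hamming_embedding (I := I) p q hp
  choose σ hσ using hspan
  let P : (ι → ZMod 2) → ProbabilityMeasure (lp (fun _ : ℕ => ℝ) (ENNReal.ofReal p)) := fun a =>
    ⟨cosetLaw K e (σ a), inferInstance⟩
  -- the laws of neighbouring cosets are at distance at most one
  have hC : ∀ (i : I) (a : (ι → ZMod 2)),
      Cstar (fun x y : lp (fun _ : ℕ => ℝ) (ENNReal.ofReal p) => ‖x - y‖ ^ q)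
        (P a : Measure (lp (fun _ : ℕ => ℝ) (ENNReal.ofReal p))) (P (a + g i)) ≤ 1 := by
    intro i a
    have hk : σ (a + g i) - (σ a + Pi.single i 1) ∈ K := by
      rw [hK, map_sub, map_add, hπ, hπ, hσ, hσ, Fintype.linearCombination_apply_single, one_smul,
        sub_self]
    have heq : cosetLaw K e (σ (a + g i)) = cosetLaw K e (σ a + Pi.single i 1) := by
      rw [← cosetLaw_add_mem K e (σ a + Pi.single i 1) hk, add_sub_cancel]
    change Cstar _ (cosetLaw K e (σ a)) (cosetLaw K e (σ (a + g i))) ≤ 1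
    rw [heq]
    refine Cstar_cosetLaw_le K e _ _ _ fun k => ?_
    rw [he]
    refine Real.rpow_le_one (by positivity) ?_ hs.le
    have : hammingDist (σ a + (k : I → ZMod 2)) (σ a + Pi.single i 1 + (k : I → ZMod 2)) ≤ 1 := by
      rw [hammingDist, Finset.card_le_one]
      have h1 : ∀ j, (σ a + (k : I → ZMod 2)) j ≠
          (σ a + (Pi.single i 1 : I → ZMod 2) + (k : I → ZMod 2)) j → j = i := by
        intro j hj
        by_contra hji
        exact hj (by simp [Pi.single_eq_of_ne hji])
      intro j hj l hl
      rw [h1 j (Finset.mem_filter.1 hj).2, h1 l (Finset.mem_filter.1 hl).2]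
    exact_mod_cast this
  -- almost surely each variable lies over its own coset
  have hae : ∀ a : ι → ZMod 2, ∀ᵐ u ∂stdSpace, ∃ x, π x = a ∧ f (P a) u = e x := by
    intro a
    have h1 : ∀ᵐ z ∂(stdSpace.map (f (P a))), z ∈ Set.range fun k : K => e (σ a + k) := by
      rw [hf.law]
      exact cosetLaw_ae K e (σ a)
    filter_upwards [ae_of_ae_map (hf.measurable _).aemeasurable h1] with u hu
    obtain ⟨k, hk⟩ := hu
    refine ⟨σ a + k, ?_, hk.symm⟩
    rw [map_add, (hK _).1 k.2, add_zero, hπ, hσ]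
  have hasm : ∀ a : ι → ZMod 2, AEStronglyMeasurable (f (P a)) stdSpace := by
    intro a
    rw [aestronglyMeasurable_iff_aemeasurable_separable]
    refine ⟨(hf.measurable _).aemeasurable, Set.range e, (Set.finite_range e).isSeparable, ?_⟩
    filter_upwards [hae a] with u hu
    obtain ⟨x, -, hx⟩ := hu
    exact ⟨x, hx.symm⟩
  set n : ℝ := (Fintype.card I : ℝ) with hn
  set N : ℝ := (Fintype.card (ι → ZMod 2) : ℝ) with hN
  have hnN : 0 < n * N := by
    rw [hn, hN]
    have h1 : 0 < Fintype.card I := Fintype.card_pos_iff.2 ⟨i₀⟩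
    have h2 : 0 < Fintype.card (ι → ZMod 2) := Fintype.card_pos
    positivity
  have hlow : ∀ᵐ u ∂stdSpace, ENNReal.ofReal ((R : ℝ) ^ min (q / p) 1 * (n * N) / 8) ≤
      ∑ i : I, ∑ a : ι → ZMod 2, ENNReal.ofReal (‖f (P a) u - f (P (a + g i)) u‖ ^ q) := by
    filter_upwards [ae_all_iff.2 hae] with u hu
    choose y hy hfy using hu
    have := le_sum_hammingDist_rpow g i₀ h₀ hg R hR hcard (q / p) hs y fun a => by
      rw [← hπ, hy]
    refine (ENNReal.ofReal_le_ofReal this).trans (le_of_eq ?_)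
    rw [ENNReal.ofReal_sum_of_nonneg fun i _ => by positivity]
    refine Finset.sum_congr rfl fun i _ => ?_
    rw [ENNReal.ofReal_sum_of_nonneg fun i _ => by positivity]
    refine Finset.sum_congr rfl fun a _ => ?_
    rw [hfy, hfy, he]
  have hstd : stdSpace Set.univ = 1 := by simp [stdSpace]
  have hmeas : ∀ (i : I) (a : (ι → ZMod 2)), AEMeasurable
      (fun u => ENNReal.ofReal (‖f (P a) u - f (P (a + g i)) u‖ ^ q)) stdSpace := by
    intro i a
    exact (((hasm a).sub (hasm _)).norm.aemeasurable.pow_const q).ennreal_ofReal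
  have hmain : ENNReal.ofReal ((R : ℝ) ^ min (q / p) 1 * (n * N) / 8) ≤
      ENNReal.ofReal (n * N) * r := by
    calc ENNReal.ofReal ((R : ℝ) ^ min (q / p) 1 * (n * N) / 8)
        = ∫⁻ _, ENNReal.ofReal ((R : ℝ) ^ min (q / p) 1 * (n * N) / 8) ∂stdSpace := by
          rw [lintegral_const, hstd, mul_one]
      _ ≤ ∫⁻ u, ∑ i : I, ∑ a : ι → ZMod 2,
            ENNReal.ofReal (‖f (P a) u - f (P (a + g i)) u‖ ^ q) ∂stdSpace :=
          lintegral_mono_ae hlow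
      _ = ∑ i : I, ∑ a : ι → ZMod 2, ∫⁻ u,
            ENNReal.ofReal (‖f (P a) u - f (P (a + g i)) u‖ ^ q) ∂stdSpace := by
          rw [lintegral_finsetSum' _ fun i _ => Finset.aemeasurable_fun_sum _ fun a _ => hmeas i a]
          exact Finset.sum_congr rfl fun i _ => lintegral_finsetSum' _ fun a _ => hmeas i a
      _ ≤ ∑ _i : I, ∑ _a : ι → ZMod 2, r :=
          Finset.sum_le_sum fun i _ => Finset.sum_le_sum fun a _ =>
            (hr (P a) (P (a + g i))).trans (mul_le_of_le_one_right' (hC i a))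
      _ = ENNReal.ofReal (n * N) * r := by
          rw [Finset.sum_const, Finset.sum_const, Finset.card_univ, Finset.card_univ, hn, hN,
            ENNReal.ofReal_mul (by positivity), ENNReal.ofReal_natCast, ENNReal.ofReal_natCast,
            nsmul_eq_mul, nsmul_eq_mul, mul_assoc]
  have hsplit : (R : ℝ) ^ min (q / p) 1 * (n * N) / 8 = n * N * ((R : ℝ) ^ min (q / p) 1 / 8) := by
    ring
  rw [hsplit, ENNReal.ofReal_mul hnN.le] at hmain
  exact (ENNReal.mul_le_mul_iff_right (ENNReal.ofReal_pos.2 hnN).ne' ENNReal.ofReal_ne_top).1 hmain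

/-- For each `R` the coupling ratio is at least `R ^ min (q / p) 1 / 8`. -/
lemma rpow_le_of_isCoupling (p q : ℝ) (hp : 1 ≤ p) (hq : 0 < q)
    [Fact (1 ≤ ENNReal.ofReal p)]
    [MeasurableSpace (lp (fun _ : ℕ => ℝ) (ENNReal.ofReal p))]
    [BorelSpace (lp (fun _ : ℕ => ℝ) (ENNReal.ofReal p))]
    (f : ProbabilityMeasure (lp (fun _ : ℕ => ℝ) (ENNReal.ofReal p)) → ℝ →
      lp (fun _ : ℕ => ℝ) (ENNReal.ofReal p))
    (hf : IsCoupling (fun P : ProbabilityMeasure (lp (fun _ : ℕ => ℝ) (ENNReal.ofReal p)) =>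
      (P : Measure (lp (fun _ : ℕ => ℝ) (ENNReal.ofReal p)))) f)
    (r : ℝ≥0∞)
    (hr : ∀ a b, ∫⁻ u, ENNReal.ofReal (‖f a u - f b u‖ ^ q) ∂stdSpace ≤
      r * Cstar (fun x y : lp (fun _ : ℕ => ℝ) (ENNReal.ofReal p) => ‖x - y‖ ^ q)
        (a : Measure (lp (fun _ : ℕ => ℝ) (ENNReal.ofReal p)))
        (b : Measure (lp (fun _ : ℕ => ℝ) (ENNReal.ofReal p))))
    (R : ℕ) (hR : 0 < R) :
    ENNReal.ofReal ((R : ℝ) ^ min (q / p) 1 / 8) ≤ r := by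
  refine rpow_le_of_isCoupling_of_spectral_gap (ι := Fin (2 * R + 1) × Fin (2 * R + 1)) rankOne 0
    (by ext; simp [rankOne]) two_mul_sum_cubeChar_rankOne_le exists_sum_smul_rankOne R hR ?_
    p q hp hq f hf r hr
  simp only [Fintype.card_prod, Fintype.card_fun, Fintype.card_fin, ZMod.card]
  rw [← pow_add, ← pow_mul, ← pow_succ']
  exact Nat.pow_le_pow_right two_pos (by nlinarith)

/-- for real `p ∈ [1,∞)` and `q > 0`, the cost
`c(x,y) = ‖x − y‖_p^q` on the sequence space `ℓ_p` (with its Borel σ-algebra) has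
infinite optimal pairwise coupling ratio: `r*_c(P(ℓ_p)) = ∞`. -/
theorem lp_sequence_space_optRatio_eq_top (p q : ℝ) (hp : 1 ≤ p) (hq : 0 < q)
    [Fact (1 ≤ ENNReal.ofReal p)]
    [m : MeasurableSpace (lp (fun _ : ℕ => ℝ) (ENNReal.ofReal p))]
    [BorelSpace (lp (fun _ : ℕ => ℝ) (ENNReal.ofReal p))] :
    optRatio (fun x y : lp (fun _ : ℕ => ℝ) (ENNReal.ofReal p) => ‖x - y‖ ^ q)
        (fun P : ProbabilityMeasure (lp (fun _ : ℕ => ℝ) (ENNReal.ofReal p)) =>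
          (P : Measure (lp (fun _ : ℕ => ℝ) (ENNReal.ofReal p)))) = ⊤ := by
  rw [optRatio, iInf₂_eq_top]
  intro f hf
  rw [couplingRatio, sInf_eq_top]
  rintro r ⟨-, hr⟩
  have hs : 0 < min (q / p) 1 := lt_min (div_pos hq (by linarith)) one_pos
  have ht : Filter.Tendsto (fun R : ℕ => ENNReal.ofReal ((R : ℝ) ^ min (q / p) 1 / 8))
      Filter.atTop (nhds ⊤) :=
    ENNReal.tendsto_ofReal_atTop.comp
      (((tendsto_rpow_atTop hs).comp tendsto_natCast_atTop_atTop).atTop_div_const (by norm_num))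
  refine top_le_iff.1 (le_of_tendsto ht ?_)
  filter_upwards [Filter.eventually_gt_atTop 0] with R hR
  exact rpow_le_of_isCoupling p q hp hq f hf r hr R hR

end
end
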